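/- Let G be a 2-connected finite simple graph that does not contain the gem as an induced minor. Then G has a subset X ⊆ V(G) of at most six vertices such that every connected component of G − X is either a cograph or a path whose internal vertices all have degree two in G. -/

import Mathlib

open SimpleGraph

namespace IMWQO

/-- `H` is an induced minor of `G`: there is a family of pairwise disjoint nonempty
connected subsets of `V(G)`, indexed by `V(H)`, such that distinct branch sets are
joined by an edge of `G` iff the corresponding vertices are adjacent in `H`. -/
def IsInducedMinor {α β : Type*} (H : SimpleGraph α) (G : SimpleGraph β) : Prop :=
  ∃ μ : α → Set β,
    (∀ a, (μ a).Nonempty) ∧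
    (∀ a b, a ≠ b → Disjoint (μ a) (μ b)) ∧
    (∀ a, (G.induce (μ a)).Connected) ∧
    (∀ a b, a ≠ b → ((∃ x ∈ μ a, ∃ y ∈ μ b, G.Adj x y) ↔ H.Adj a b))

/-- A bundled finite simple graph. -/
abbrev FinGraph := Σ n : ℕ, SimpleGraph (Fin n)

/-- The induced minor relation on bundled finite graphs. -/
def FinGraph.IM (H G : FinGraph) : Prop := IsInducedMinor H.2 G.2

/-- A class of finite graphs is well-quasi-ordered by the induced minor relation. -/
def WqoClass (P : FinGraph → Prop) : Prop :=
  ∀ f : ℕ → FinGraph, (∀ i, P (f i)) → ∃ i j, i < j ∧ FinGraph.IM (f i) (f j)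

/-- `K̂₄`: `K₄` (on vertices `0,1,2,3`) plus a vertex `4` adjacent to `0` and `1`. -/
def hatK4 : SimpleGraph (Fin 5) :=
  SimpleGraph.fromRel fun a b =>
    (a.val < 4 ∧ b.val < 4) ∨ (a.val = 4 ∧ (b.val = 0 ∨ b.val = 1))

/-- The gem: the path `0 - 1 - 2 - 3` plus a dominating vertex `4`. -/
def gem : SimpleGraph (Fin 5) :=
  SimpleGraph.fromRel fun a b =>
    (b.val = a.val + 1 ∧ b.val ≤ 3) ∨ a.val = 4

/-- The complete graph on four vertices. -/
def K4 : SimpleGraph (Fin 4) := ⊤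

/-- The prism, i.e. the Cartesian (box) product `K₃ □ K₂`. -/
def prism : SimpleGraph (Fin 3 × Fin 2) :=
  (⊤ : SimpleGraph (Fin 3)) □ (⊤ : SimpleGraph (Fin 2))

/-- The complete bipartite graph `K_{3,3}`. -/
def K33 : SimpleGraph (Fin 3 ⊕ Fin 3) := completeBipartiteGraph (Fin 3) (Fin 3)

/-- Subdivide the edge `{u,v}` of `G`, the new vertex being `Fin.last n`. -/
def subdivideEdge {n : ℕ} (G : SimpleGraph (Fin n)) (u v : Fin n) :
    SimpleGraph (Fin (n + 1)) :=
  SimpleGraph.fromRel fun a b =>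
    (∃ a' b' : Fin n, a = a'.castSucc ∧ b = b'.castSucc ∧ G.Adj a' b' ∧
      ¬(a' = u ∧ b' = v) ∧ ¬(a' = v ∧ b' = u))
    ∨ (a = Fin.last n ∧ (b = u.castSucc ∨ b = v.castSucc))

/-- One subdivision step on bundled graphs: the first graph is obtained from the
second one by subdividing one edge. -/
inductive SubdivStep : FinGraph → FinGraph → Prop
  | mk {n : ℕ} (G : SimpleGraph (Fin n)) (u v : Fin n) (h : G.Adj u v) :
      SubdivStep ⟨n + 1, subdivideEdge G u v⟩ ⟨n, G⟩

/-- `G` is (isomorphic to) a subdivision of `H`. -/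
def IsSubdivision {α β : Type*} (G : SimpleGraph α) (H : SimpleGraph β) : Prop :=
  ∃ A B : FinGraph, Nonempty (G ≃g A.2) ∧ Nonempty (H ≃g B.2) ∧
    Relation.ReflTransGen SubdivStep A B

/-- `G` contains a subdivision of `H` as a subgraph. -/
def ContainsSubdivAsSubgraph {α β : Type*} (G : SimpleGraph α) (H : SimpleGraph β) : Prop :=
  ∃ S : G.Subgraph, IsSubdivision S.coe H

/-- `G` has a proper `K₄`-subdivision: for some vertex `v`, `G - v` contains
a subdivision of `K₄` as a subgraph. -/
def HasProperK4Subdivision {α : Type*} (G : SimpleGraph α) : Prop :=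
  ∃ v : α, ContainsSubdivAsSubgraph (G.induce {u | u ≠ v}) K4

/-- `G` is 2-connected: at least 3 vertices, and removing any vertex leaves it connected. -/
def TwoConnected {α : Type*} [Fintype α] (G : SimpleGraph α) : Prop :=
  3 ≤ Fintype.card α ∧ ∀ v : α, (G.induce {u | u ≠ v}).Connected

/-- `G` is complete multipartite: two vertices are adjacent iff they lie in different
classes of some partition (equivalence relation). -/
def IsCompleteMultipartite {α : Type*} (G : SimpleGraph α) : Prop :=
  ∃ s : Setoid α, ∀ u v, G.Adj u v ↔ ¬ s.r u v

/-- `G` is a cograph: it has no induced path on four vertices. -/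
def IsCograph {α : Type*} (G : SimpleGraph α) : Prop :=
  ∀ f : Fin 4 → α, Function.Injective f →
    ¬ (∀ a b : Fin 4, G.Adj (f a) (f b) ↔ (pathGraph 4).Adj a b)

/-- `G` is a linear forest: acyclic with maximum degree at most 2,
i.e. a disjoint union of paths. -/
def IsLinearForest {α : Type*} (G : SimpleGraph α) : Prop :=
  G.IsAcyclic ∧ ∀ v, (G.neighborSet v).ncard ≤ 2

/-- The set `C` induces an (induced) cycle in `G`. -/
def InducesCycle {α : Type*} (G : SimpleGraph α) (C : Set α) : Prop :=
  ∃ n : ℕ, 3 ≤ n ∧ Nonempty ((G.induce C) ≃g cycleGraph n)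

/-- The set `S` induces a path in `G` all of whose internal vertices have degree two
in `G`. -/
def IsBasicPath {α : Type*} (G : SimpleGraph α) (S : Set α) : Prop :=
  ∃ (n : ℕ) (φ : (G.induce S) ≃g pathGraph n),
    ∀ v : S, (φ v).val ≠ 0 → (φ v).val ≠ n - 1 → (G.neighborSet v.val).ncard = 2

/-- The wheel with cycle `0, …, n-1` and center adjacent to the vertices of `T`. -/
def wheelGraph (n : ℕ) (T : Finset (Fin n)) : SimpleGraph (Fin n ⊕ Unit) :=
  SimpleGraph.fromRel fun a b =>
    (∃ x y : Fin n, a = Sum.inl x ∧ b = Sum.inl y ∧ (cycleGraph n).Adj x y)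
    ∨ (∃ x ∈ T, a = Sum.inr () ∧ b = Sum.inl x)

/-- `G` is a `k`-wheel: a cycle of order at least `max k 3` plus a center adjacent to
exactly `k` distinct vertices of the cycle. -/
def IsWheel {α : Type*} (k : ℕ) (G : SimpleGraph α) : Prop :=
  ∃ n : ℕ, 3 ≤ n ∧ k ≤ n ∧ ∃ T : Finset (Fin n), T.card = k ∧
    Nonempty (G ≃g wheelGraph n T)

/-- A 3-wheel subgraph of `G`: a cycle of `G` together with a center outside the cycle
joined to (at least) three distinct vertices of the cycle by edges of `G`. -/
structure ThreeWheelSub {α : Type*} (G : SimpleGraph α) where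
  base : α
  cyc : G.Walk base base
  cyc_isCycle : cyc.IsCycle
  center : α
  center_not_mem : center ∉ cyc.support
  spokes : Finset α
  spokes_card : spokes.card = 3
  spokes_sub : ∀ x ∈ spokes, x ∈ cyc.support
  spokes_adj : ∀ x ∈ spokes, G.Adj center x

/-- The number of vertices of a 3-wheel subgraph. -/
def ThreeWheelSub.order {α : Type*} [DecidableEq α] {G : SimpleGraph α}
    (W : ThreeWheelSub G) : ℕ :=
  W.cyc.support.toFinset.card + 1

/-- `G` has a cycle-multipartite decomposition. -/
def HasCycleMultipartiteDecomp {α : Type*} (G : SimpleGraph α) : Prop :=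
  ∃ C R : Set α, C ∪ R = Set.univ ∧ Disjoint C R ∧
    InducesCycle G C ∧ IsCompleteMultipartite (G.induce R) ∧
    ∀ u ∈ R, ∀ v ∈ R, ∀ c ∈ C, (G.Adj u c ↔ G.Adj v c)

/-- A bundled finite simple graph whose vertices are labeled by finite subsets of `S`. -/
structure LabGraph (S : Type*) where
  n : ℕ
  graph : SimpleGraph (Fin n)
  label : Fin n → Finset S

/-- The domination order on finite subsets of a quasi-order: `A ≤^P B` iff there is an
injection `φ : A → B` with `r a (φ a)` for all `a ∈ A`. -/
def FinsetLE {S : Type*} (r : S → S → Prop) (A B : Finset S) : Prop :=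
  ∃ φ : {x // x ∈ A} → {x // x ∈ B}, Function.Injective φ ∧ ∀ a, r a.val (φ a).val

/-- The union of the labels of the vertices in `A`. -/
noncomputable def labelUnion {S : Type*} {n : ℕ} (lab : Fin n → Finset S)
    (A : Finset (Fin n)) : Finset S :=
  letI := Classical.decEq S
  A.biUnion lab

/-- Label-respecting induced minor relation on labeled graphs. -/
def LabIM {S : Type*} (r : S → S → Prop) (H G : LabGraph S) : Prop :=
  ∃ μ : Fin H.n → Finset (Fin G.n),
    (∀ a, (μ a).Nonempty) ∧
    (∀ a b, a ≠ b → Disjoint (μ a) (μ b)) ∧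
    (∀ a, (G.graph.induce (↑(μ a) : Set (Fin G.n))).Connected) ∧
    (∀ a b, a ≠ b → ((∃ x ∈ μ a, ∃ y ∈ μ b, G.graph.Adj x y) ↔ H.graph.Adj a b)) ∧
    (∀ a, FinsetLE r (H.label a) (labelUnion G.label (μ a)))

/-- Label-respecting contraction relation on labeled graphs: an induced minor model
whose branch sets cover all vertices. -/
def LabContraction {S : Type*} (r : S → S → Prop) (H G : LabGraph S) : Prop :=
  ∃ μ : Fin H.n → Finset (Fin G.n),
    (∀ a, (μ a).Nonempty) ∧
    (∀ a b, a ≠ b → Disjoint (μ a) (μ b)) ∧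
    (∀ x : Fin G.n, ∃ a, x ∈ μ a) ∧
    (∀ a, (G.graph.induce (↑(μ a) : Set (Fin G.n))).Connected) ∧
    (∀ a b, a ≠ b → ((∃ x ∈ μ a, ∃ y ∈ μ b, G.graph.Adj x y) ↔ H.graph.Adj a b)) ∧
    (∀ a, FinsetLE r (H.label a) (labelUnion G.label (μ a)))

/-- Label-respecting induced subgraph relation on labeled graphs. -/
def LabISub {S : Type*} (r : S → S → Prop) (H G : LabGraph S) : Prop :=
  ∃ φ : Fin H.n → Fin G.n, Function.Injective φ ∧
    (∀ a b, H.graph.Adj a b ↔ G.graph.Adj (φ a) (φ b)) ∧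
    (∀ a, FinsetLE r (H.label a) (G.label (φ a)))

/-- A relation is a well-quasi-order: every infinite sequence contains a good pair. -/
def IsWqo {S : Type*} (r : S → S → Prop) : Prop :=
  ∀ g : ℕ → S, ∃ i j, i < j ∧ r (g i) (g j)

section Bags

variable {α : Type*} {G : SimpleGraph α} {A B C M K : Set α} {x y t z : α}

/-- Some edge of `G` joins `A` to `B`. -/
def Touch (G : SimpleGraph α) (A B : Set α) : Prop := ∃ x ∈ A, ∃ y ∈ B, G.Adj x y

/-- `A` is a nonempty set inducing a connected subgraph of `G`. -/
def Conn (G : SimpleGraph α) (A : Set α) : Prop := (G.induce A).Connected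

/-- `K` is the vertex set of a connected component of `G[M]`. -/
def IsComp (G : SimpleGraph α) (M K : Set α) : Prop :=
  K ⊆ M ∧ Conn G K ∧ ∀ x ∈ K, ∀ y ∈ M, G.Adj x y → y ∈ K

lemma Touch.symm (h : Touch G A B) : Touch G B A := by
  obtain ⟨x, hx, y, hy, h⟩ := h
  exact ⟨y, hy, x, hx, h.symm⟩

lemma Touch.mono {A' B' : Set α} (h : Touch G A B) (hA : A ⊆ A') (hB : B ⊆ B') :
    Touch G A' B' := by
  obtain ⟨x, hx, y, hy, h⟩ := h
  exact ⟨x, hA hx, y, hB hy, h⟩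

lemma touch_singleton_right : Touch G A {x} ↔ ∃ a ∈ A, G.Adj a x := by
  simp [Touch]

lemma conn_iff : Conn G A ↔ A.Nonempty ∧ ∀ B ⊆ A, B.Nonempty →
    (∀ x ∈ B, ∀ y ∈ A, G.Adj x y → y ∈ B) → A ⊆ B := by
  unfold Conn
  constructor
  · intro h
    refine ⟨?_, ?_⟩
    · obtain ⟨x⟩ := h.nonempty
      exact ⟨x, x.2⟩
    · rintro B hBA ⟨b, hb⟩ hcl a ha
      obtain ⟨w⟩ := h.preconnected ⟨b, hBA hb⟩ ⟨a, ha⟩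
      suffices ∀ (p q : A), (G.induce A).Walk p q → p.1 ∈ B → q.1 ∈ B from this _ _ w hb
      intro p q w
      induction w with
      | nil => exact id
      | cons hadj _ ih => exact fun hp => ih (hcl _ hp _ (Subtype.prop _) hadj)
  · rintro ⟨⟨a, ha⟩, h⟩
    have : Nonempty A := ⟨⟨a, ha⟩⟩
    refine connected_iff_exists_forall_reachable _ |>.2 ⟨⟨a, ha⟩, ?_⟩
    have := h {y | ∃ hy : y ∈ A, (G.induce A).Reachable ⟨a, ha⟩ ⟨y, hy⟩}
      (fun y hy => hy.1) ⟨a, ha, Reachable.refl _⟩ (by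
        rintro x ⟨hx, hr⟩ y hy hxy
        exact ⟨hy, hr.trans (Adj.reachable (by simpa using hxy))⟩)
    rintro ⟨y, hy⟩
    exact (this hy).2

lemma Conn.nonempty (h : Conn G A) : A.Nonempty := (conn_iff.1 h).1

lemma Conn.subset_of_closed (h : Conn G A) (hx : x ∈ A) (hxB : x ∈ B)
    (hcl : ∀ x ∈ B, x ∈ A → ∀ y ∈ A, G.Adj x y → y ∈ B) : A ⊆ B := by
  have := (conn_iff.1 h).2 (A ∩ B) Set.inter_subset_left ⟨x, hx, hxB⟩
    (fun a ha b hb hab => ⟨hb, hcl a ha.2 ha.1 b hb hab⟩)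
  exact fun a ha => (this ha).2

/-- A connected set meeting `B` and not contained in `B` has an edge leaving `B`. -/
lemma Conn.exists_adj (h : Conn G A) (hx : x ∈ A) (hxB : x ∈ B) (hy : y ∈ A) (hyB : y ∉ B) :
    ∃ a ∈ A, a ∈ B ∧ ∃ b ∈ A, b ∉ B ∧ G.Adj a b := by
  by_contra hc
  push Not at hc
  exact hyB (h.subset_of_closed hx hxB (fun a ha ha' b hb hab => by
    by_contra hbB; exact hc a ha' ha b hb hbB hab) hy)

lemma conn_singleton (x : α) : Conn G {x} := by
  rw [conn_iff]
  refine ⟨⟨x, rfl⟩, ?_⟩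
  rintro B hB ⟨b, hb⟩ - a rfl
  obtain rfl : b = a := hB hb
  exact hb

lemma Conn.union_of_inter (hA : Conn G A) (hB : Conn G B) (hx : x ∈ A) (hx' : x ∈ B) :
    Conn G (A ∪ B) :=
  induce_union_connected hA.preconnected hB.preconnected ⟨x, hx, hx'⟩

lemma Conn.union (hA : Conn G A) (hB : Conn G B) (h : Touch G A B) : Conn G (A ∪ B) := by
  obtain ⟨x, hx, y, hy, h⟩ := h
  have hp : Conn G {x, y} := induce_pair_connected_of_adj h
  have := (hA.union_of_inter hp hx (by simp)).union_of_inter hB (x := y) (by simp) hy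
  convert this using 1
  ext z; simp only [Set.mem_union, Set.mem_insert_iff, Set.mem_singleton_iff]; grind

lemma IsComp.subset (h : IsComp G M K) : K ⊆ M := h.1
lemma IsComp.conn (h : IsComp G M K) : Conn G K := h.2.1
lemma IsComp.mem_of_adj (h : IsComp G M K) (hx : x ∈ K) (hy : y ∈ M) (hxy : G.Adj x y) :
    y ∈ K := h.2.2 x hx y hy hxy

lemma exists_isComp (G : SimpleGraph α) (hx : x ∈ M) : ∃ K, IsComp G M K ∧ x ∈ K := by
  refine ⟨⋃₀ {A | A ⊆ M ∧ Conn G A ∧ x ∈ A}, ⟨?_, ?_, ?_⟩, ?_⟩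
  · exact Set.sUnion_subset fun A hA => hA.1
  · rw [conn_iff]
    refine ⟨⟨x, {x}, ⟨by simpa using hx, conn_singleton x, rfl⟩, rfl⟩, ?_⟩
    rintro B hB ⟨b, hb⟩ hcl
    have key : ∀ A, A ⊆ M ∧ Conn G A ∧ x ∈ A → ∀ y ∈ A, y ∈ B → A ⊆ B := by
      intro A hA y hy hyB
      exact hA.2.1.subset_of_closed hy hyB
        (fun a ha _ b hb hab => hcl a ha b ⟨A, hA, hb⟩ hab)
    obtain ⟨A, hA, hbA⟩ := hB hb
    have hxB := key A hA b hbA hb hA.2.2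
    exact Set.sUnion_subset fun A' hA' => key A' hA' x hA'.2.2 hxB
  · rintro a ⟨A, hA, ha⟩ b hb hab
    refine ⟨A ∪ {b}, ⟨?_, ?_, Or.inl hA.2.2⟩, Or.inr rfl⟩
    · exact Set.union_subset hA.1 (by simpa using hb)
    · exact hA.2.1.union (conn_singleton b) ⟨a, ha, b, rfl, hab⟩
  · exact ⟨{x}, ⟨by simpa using hx, conn_singleton x, rfl⟩, rfl⟩

lemma IsComp.subset_of_conn (h : IsComp G M K) (hA : Conn G A) (hAM : A ⊆ M) (hx : x ∈ A)
    (hxK : x ∈ K) : A ⊆ K :=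
  hA.subset_of_closed hx hxK (fun _ ha _ _ hb hab => h.mem_of_adj ha (hAM hb) hab)

lemma exists_isComp_of_conn (hA : Conn G A) (hAM : A ⊆ M) : ∃ K, IsComp G M K ∧ A ⊆ K := by
  obtain ⟨x, hx⟩ := hA.nonempty
  obtain ⟨K, hK, hxK⟩ := exists_isComp G (hAM hx)
  exact ⟨K, hK, hK.subset_of_conn hA hAM hx hxK⟩

/-- After removing a set `Z` from a connected set `F`, every component of the rest touches `Z`. -/
lemma IsComp.touch_of_conn {F Z : Set α} (hF : Conn G F) (hZ : Z.Nonempty) (hZF : Z ⊆ F)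
    (hK : IsComp G (F \ Z) K) : Touch G K Z := by
  obtain ⟨x, hx⟩ := hK.conn.nonempty
  obtain ⟨z, hz⟩ := hZ
  obtain ⟨a, ha, haK, b, hb, hbK, hab⟩ :=
    hF.exists_adj (hK.subset hx).1 hx (hZF hz) (fun h => (hK.subset h).2 hz)
  refine ⟨a, haK, b, ?_, hab⟩
  by_contra hbZ
  exact hbK (hK.mem_of_adj haK ⟨hb, hbZ⟩ hab)

/-- Removing one component of `F ∖ Z` from a connected set `F` keeps it connected. -/
lemma IsComp.conn_diff {F Z : Set α} (hF : Conn G F) (hZ : Conn G Z) (hZF : Z ⊆ F)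
    (hK : IsComp G (F \ Z) K) : Conn G (F \ K) := by
  have hZK : ∀ z ∈ Z, z ∉ K := fun z hz h => (hK.subset h).2 hz
  obtain ⟨z, hz⟩ := hZ.nonempty
  rw [conn_iff]
  refine ⟨⟨z, hZF hz, hZK z hz⟩, ?_⟩
  rintro B hB ⟨b, hb⟩ hcl
  have key : z ∈ B := by
    by_cases hbZ : b ∈ Z
    · exact hZ.subset_of_closed hbZ hb (fun x hx _ y hy hxy =>
        hcl x hx y ⟨hZF hy, hZK y hy⟩ hxy) hz
    · obtain ⟨L, hL, hbL⟩ := exists_isComp G (M := F \ Z) (x := b) ⟨(hB hb).1, hbZ⟩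
      have hLK : ∀ y ∈ L, y ∉ K := by
        intro y hy hyK
        exact (hB hb).2 (hK.subset_of_conn hL.conn hL.subset hy hyK hbL)
      have hLB : L ⊆ B := hL.conn.subset_of_closed hbL hb (fun x hx _ y hy hxy =>
        hcl x hx y ⟨(hL.subset hy).1, hLK y hy⟩ hxy)
      obtain ⟨x, hx, y, hy, hxy⟩ := hL.touch_of_conn hF ⟨z, hz⟩ hZF
      have hyB := hcl x (hLB hx) y ⟨hZF hy, hZK y hy⟩ hxy
      exact hZ.subset_of_closed hy hyB (fun x hx _ y hy hxy =>
        hcl x hx y ⟨hZF hy, hZK y hy⟩ hxy) hz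
  have : F ⊆ B ∪ K := by
    refine hF.subset_of_closed (hZF hz) (Or.inl key) ?_
    rintro x (hx | hx) hxF y hy hxy
    · by_cases hyK : y ∈ K
      · exact Or.inr hyK
      · exact Or.inl (hcl x hx y ⟨hy, hyK⟩ hxy)
    · by_cases hyZ : y ∈ Z
      · left
        exact hZ.subset_of_closed hz key (fun x hx _ y hy hxy =>
          hcl x hx y ⟨hZF hy, hZK y hy⟩ hxy) hyZ
      · exact Or.inr (hK.mem_of_adj hx ⟨hy, hyZ⟩ hxy)
  rintro x ⟨hx, hxK⟩
  exact (this hx).resolve_right hxK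

/-- In a 2-connected graph, the neighbourhood of `D` is not contained in `{t}` unless `D`
together with `t` covers all vertices. -/
lemma TwoConnected.exists_adj [Fintype α] (h : TwoConnected G) {D : Set α} (hx : x ∈ D)
    (ht : t ∉ D) (hz : z ∉ D) (hzt : z ≠ t) : ∃ x ∈ D, ∃ y, y ∉ D ∧ y ≠ t ∧ G.Adj x y := by
  have hc : Conn G {u | u ≠ t} := h.2 t
  obtain ⟨a, -, haD, b, hb, hbD, hab⟩ := hc.exists_adj (B := D) (x := x) (y := z)
    (by rintro rfl; exact ht hx) hx hzt hz
  exact ⟨a, haD, b, hbD, hb, hab⟩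

/-- Five bags forming a model of the gem: hub `H`, path `P Q R S`. -/
lemma gem_of {H P Q R S : Set α} (cH : Conn G H) (cP : Conn G P) (cQ : Conn G Q)
    (cR : Conn G R) (cS : Conn G S)
    (hd : (∀ x ∈ H, x ∉ P ∧ x ∉ Q ∧ x ∉ R ∧ x ∉ S) ∧ (∀ x ∈ P, x ∉ Q ∧ x ∉ R ∧ x ∉ S) ∧
      (∀ x ∈ Q, x ∉ R ∧ x ∉ S) ∧ (∀ x ∈ R, x ∉ S))
    (hHP : Touch G H P) (hHQ : Touch G H Q) (hHR : Touch G H R) (hHS : Touch G H S)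
    (hPQ : Touch G P Q) (hQR : Touch G Q R) (hRS : Touch G R S)
    (nPR : ¬ Touch G P R) (nPS : ¬ Touch G P S) (nQS : ¬ Touch G Q S) :
    IsInducedMinor gem G := by
  refine ⟨![P, Q, R, S, H], ?_, ?_, ?_, ?_⟩
  · intro a; fin_cases a
    exacts [cP.nonempty, cQ.nonempty, cR.nonempty, cS.nonempty, cH.nonempty]
  · intro a b hab
    rw [Set.disjoint_left]
    fin_cases a <;> fin_cases b <;> simp at hab ⊢ <;> grind
  · intro a; fin_cases a
    exacts [cP, cQ, cR, cS, cH]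
  · intro a b hab
    have tr : ∀ {X Y : Set α} {p : Prop}, p → Touch G X Y → (Touch G X Y ↔ p) :=
      fun hp h => ⟨fun _ => hp, fun _ => h⟩
    have fa : ∀ {X Y : Set α} {p : Prop}, ¬ p → ¬ Touch G X Y → (Touch G X Y ↔ p) :=
      fun hp h => ⟨fun h' => (h h').elim, fun h' => (hp h').elim⟩
    change Touch G _ _ ↔ _
    fin_cases a <;> fin_cases b <;>
      first
      | exact absurd rfl hab
      | (refine tr (by simp [gem]) ?_
         first | assumption | (apply Touch.symm; assumption))
      | (refine fa (by simp [gem]) ?_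
         first | assumption | (intro h; have h := h.symm; revert h; assumption))

end Bags

section Attachments

variable {α : Type*} {G : SimpleGraph α}

/-- If a connected set `W` is attached only to `u` and to a connected set `V`, both of which touch
a common connected set away from `W`, then `u` is complete to `W` or has a unique neighbour in
`W`. -/
lemma exists_unique_attachment [Fintype α] (h2 : TwoConnected G) (hg : ¬ IsInducedMinor gem G)
    {u s₀ : α} {R V W : Set α} (cR : Conn G R) (cV : Conn G V) (cW : Conn G W)
    (huR : u ∉ R) (huV : u ∉ V) (huW : u ∉ W)
    (dRV : ∀ x ∈ R, x ∉ V) (dRW : ∀ x ∈ R, x ∉ W) (dVW : ∀ x ∈ V, x ∉ W)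
    (tRu : Touch G R {u}) (tRV : Touch G R V) (nRW : ¬ Touch G R W) (tuV : Touch G {u} V)
    (hN : ∀ x ∈ W, ∀ y, G.Adj x y → y ∈ W ∨ y = u ∨ y ∈ V)
    (tWu : Touch G W {u}) (hs₀ : s₀ ∈ W) (hus₀ : ¬ G.Adj u s₀) :
    ∃ t ∈ W, (∀ w ∈ W, G.Adj u w ↔ w = t) ∧ ¬ Touch G {t} V ∧ Conn G (W \ {t}) := by
  obtain ⟨v₀, hv₀⟩ := cV.nonempty
  obtain ⟨s, hs, hs₀s⟩ := exists_isComp G (M := {x | x ∈ W ∧ ¬ G.Adj u x}) (x := s₀) ⟨hs₀, hus₀⟩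
  have hsW : ∀ x ∈ s, x ∈ W ∧ ¬ G.Adj u x := fun x hx => hs.subset hx
  have hsN : ∀ x ∈ s, ∀ y ∈ W, G.Adj x y → y ∉ s → G.Adj u y := by
    intro x hx y hy hxy hys
    by_contra hc
    exact hys (hs.mem_of_adj hx ⟨hy, hc⟩ hxy)
  obtain ⟨F, hF, hVF⟩ := exists_isComp_of_conn (M := (W ∪ V) \ s) cV
    (fun x hx => ⟨Or.inr hx, fun h => dVW x hx (hsW x h).1⟩)
  have hFs : ∀ x ∈ F, (x ∈ W ∨ x ∈ V) ∧ x ∉ s := fun x hx => hF.subset hx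
  have hFN : ∀ x ∈ F, ∀ y, (y ∈ W ∨ y ∈ V) → y ∉ s → G.Adj x y → y ∈ F :=
    fun x hx y hy hys hxy => hF.mem_of_adj hx ⟨hy, hys⟩ hxy
  have hFW : ∀ x ∈ F, x ∉ W := by
    intro x hxF hxW
    obtain ⟨Y, hY, hxY⟩ := exists_isComp G (M := W \ s) (x := x) ⟨hxW, (hFs x hxF).2⟩
    have hYF : Y ⊆ F := hF.subset_of_conn hY.conn
      (fun y hy => ⟨Or.inl (hY.subset hy).1, (hY.subset hy).2⟩) hxY hxF
    obtain ⟨f, hfY, s₁, hs₁, hfs⟩ := hY.touch_of_conn cW ⟨s₀, hs₀s⟩ (fun x hx => (hsW x hx).1)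
    have hfW := (hY.subset hfY).1
    have hfF := hYF hfY
    have huf : G.Adj u f := hsN s₁ hs₁ f hfW hfs.symm (hFs f hfF).2
    obtain ⟨F₀, hF₀, hVF₀⟩ := exists_isComp_of_conn (M := F \ {f}) cV
      (fun x hx => ⟨hVF hx, by rintro rfl; exact dVW x hx hfW⟩)
    have hF₀F : ∀ x ∈ F₀, x ∈ F ∧ x ≠ f := fun x hx => hF₀.subset hx
    obtain ⟨x₀, hx₀, hx₀f⟩ := touch_singleton_right.1
      (hF₀.touch_of_conn hF.conn (Set.singleton_nonempty f) (by simpa using hfF))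
    have cD := hF₀.conn_diff hF.conn (conn_singleton f) (by simpa using hfF)
    by_cases hsF₀ : Touch G F₀ s
    · refine hg (gem_of hF₀.conn cR (conn_singleton u) cD hs.conn ?_ (tRV.symm.mono hVF₀ le_rfl)
        (tuV.symm.mono hVF₀ le_rfl) ⟨x₀, hx₀, f, ⟨hfF, fun h => (hF₀F f h).2 rfl⟩, hx₀f⟩ hsF₀ tRu
        ⟨u, rfl, f, ⟨hfF, fun h => (hF₀F f h).2 rfl⟩, huf⟩
        ⟨f, ⟨hfF, fun h => (hF₀F f h).2 rfl⟩, s₁, hs₁, hfs⟩ ?_ ?_ ?_)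
      · grind
      · rintro ⟨x, hx, y, hy, hxy⟩
        exact nRW ⟨x, hx, y, (hFs y hy.1).1.resolve_right (fun h => hy.2 (hVF₀ h)), hxy⟩
      · rintro ⟨x, hx, y, hy, hxy⟩
        exact nRW ⟨x, hx, y, (hsW y hy).1, hxy⟩
      · rintro ⟨x, rfl, y, hy, hxy⟩
        exact (hsW y hy).2 hxy
    · obtain ⟨E, hE, hsE⟩ := exists_isComp_of_conn (M := (W ∪ V) \ ({f} ∪ F₀)) hs.conn
        (by
          intro x hx
          have := hsW x hx
          refine ⟨Or.inl this.1, ?_⟩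
          rintro (rfl | h)
          · exact this.2 huf
          · exact (hFs x (hF₀F x h).1).2 hx)
      have hEW : ∀ x ∈ E, x ∈ W ∧ x ≠ f ∧ x ∉ F₀ := by
        intro x hx
        have := hE.subset hx
        simp only [Set.mem_sdiff, Set.mem_union, Set.mem_singleton_iff] at this
        grind
      have hEF₀ : ∀ x ∈ E, ∀ y ∈ F₀, ¬ G.Adj x y := by
        intro x hx y hy hxy
        have hxE := hEW x hx
        by_cases hxs : x ∈ s
        · exact hsF₀ ⟨y, hy, x, hxs, hxy.symm⟩
        · have := hFN y (hF₀F y hy).1 x (Or.inl hxE.1) hxs hxy.symm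
          exact hxE.2.2 (hF₀.mem_of_adj hy ⟨this, hxE.2.1⟩ hxy.symm)
      have hEu : Touch G {u} E := by
        obtain ⟨x, hx, y, hyE, hyf, hxy⟩ := h2.exists_adj (hsE hs₀s)
          (fun h => (hEW f h).2.1 rfl) (z := u) (fun h => huW (hEW u h).1)
          (by rintro rfl; exact huW hfW)
        by_cases hyu : y = u
        · subst hyu; exact ⟨y, rfl, x, hx, hxy.symm⟩
        · have hy := hN x (hEW x hx).1 y hxy
          refine (hyE (hE.mem_of_adj hx ⟨?_, ?_⟩ hxy)).elim
          · rcases hy with h | h | h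
            exacts [Or.inl h, (hyu h).elim, Or.inr h]
          · rintro (h | h)
            exacts [hyf h, hEF₀ x hx y h hxy]
      refine hg (gem_of (conn_singleton u) hE.conn (conn_singleton f) hF₀.conn cR ?_ hEu
        ⟨u, rfl, f, rfl, huf⟩ (tuV.mono le_rfl hVF₀) tRu.symm ⟨s₁, hsE hs₁, f, rfl, hfs.symm⟩
        ⟨f, rfl, x₀, hx₀, hx₀f.symm⟩ (tRV.symm.mono hVF₀ le_rfl) ?_ ?_ ?_)
      · grind
      · rintro ⟨x, hx, y, hy, hxy⟩
        exact hEF₀ x hx y hy hxy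
      · rintro ⟨x, hx, y, hy, hxy⟩
        exact nRW ⟨y, hy, x, (hEW x hx).1, hxy.symm⟩
      · rintro ⟨x, rfl, y, hy, hxy⟩
        exact nRW ⟨y, hy, x, hfW, hxy.symm⟩
  have hVs : ∀ x ∈ W, ∀ y ∈ V, G.Adj x y → x ∈ s := by
    intro x hx y hy hxy
    by_contra hxs
    exact hFW x (hFN y (hVF hy) x (Or.inl hx) hxs hxy.symm) hx
  have tVs : Touch G V s := by
    obtain ⟨x, hx, y, hyW, hyu, hxy⟩ := h2.exists_adj hs₀ huW (z := v₀) (dVW v₀ hv₀)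
      (by rintro rfl; exact huV hv₀)
    have hyV := ((hN x hx y hxy).resolve_left hyW).resolve_left hyu
    exact ⟨y, hyV, x, hVs x hx y hyV hxy, hxy.symm⟩
  obtain ⟨t₀, ht₀, ht₀u⟩ := touch_singleton_right.1 tWu
  obtain ⟨a, -, has, t, ht, hts, hat⟩ :=
    cW.exists_adj hs₀ hs₀s ht₀ (fun h => (hsW t₀ h).2 ht₀u.symm)
  have hut := hsN a has t ht hat hts
  have huniq : ∀ w ∈ W, G.Adj u w → w = t := by
    intro t₁ ht₁ hut₁
    by_contra hne
    have cst : Conn G (s ∪ {t}) := hs.conn.union (conn_singleton t) ⟨a, has, t, rfl, hat⟩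
    have hst : s ∪ {t} ⊆ W \ {t₁} := by
      rintro x (hx | rfl)
      · exact ⟨(hsW x hx).1, by rintro rfl; exact (hsW x hx).2 hut₁⟩
      · exact ⟨ht, fun h => hne h.symm⟩
    obtain ⟨B, hB, hstB⟩ := exists_isComp_of_conn cst hst
    have hBW : ∀ x ∈ B, x ∈ W ∧ x ≠ t₁ := fun x hx => hB.subset hx
    have cD := hB.conn_diff cW (conn_singleton t₁) (by simpa using ht₁)
    have ht₁B : t₁ ∈ W \ B := ⟨ht₁, fun h => (hBW t₁ h).2 rfl⟩
    refine hg (gem_of (conn_singleton u) cR cV hB.conn cD ?_ tRu.symm tuV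
      ⟨u, rfl, t, hstB (Or.inr rfl), hut⟩ ⟨u, rfl, t₁, ht₁B, hut₁⟩ tRV
      (tVs.mono le_rfl (fun x hx => hstB (Or.inl hx))) ?_ ?_ ?_ ?_)
    · grind
    · exact (hB.touch_of_conn cW (Set.singleton_nonempty t₁) (by simpa using ht₁)).mono le_rfl
        (by simpa using ht₁B)
    · exact fun h => nRW (h.mono le_rfl (fun x hx => (hBW x hx).1))
    · exact fun h => nRW (h.mono le_rfl (fun x hx => hx.1))
    · rintro ⟨x, hx, y, hy, hxy⟩
      exact hy.2 (hstB (Or.inl (hVs y hy.1 x hx hxy.symm)))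
  refine ⟨t, ht, fun w hw => ⟨huniq w hw, by rintro rfl; exact hut⟩, ?_, ?_⟩
  · rintro ⟨x, rfl, y, hy, hxy⟩
    exact hts (hVs x ht y hy hxy)
  · obtain ⟨S, hS, hsS⟩ := exists_isComp_of_conn (M := W \ {t}) hs.conn
      (fun x hx => ⟨(hsW x hx).1, by rintro rfl; exact hts hx⟩)
    have : W \ {t} = S := by
      refine Set.Subset.antisymm ?_ hS.subset
      intro y hy
      obtain ⟨D, hD, hyD⟩ := exists_isComp G hy
      have hDW : ∀ x ∈ D, x ∈ W ∧ x ≠ t := fun x hx => hD.subset hx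
      obtain ⟨x, hx, z, hzD, hzt, hxz⟩ := h2.exists_adj hyD (fun h => (hDW t h).2 rfl) (z := u)
        (fun h => huW (hDW u h).1) (by rintro rfl; exact huW ht)
      rcases hN x (hDW x hx).1 z hxz with h | rfl | h
      · exact (hzD (hD.mem_of_adj hx ⟨h, hzt⟩ hxz)).elim
      · exact ((hDW x hx).2 (huniq x (hDW x hx).1 hxz.symm)).elim
      · exact hS.subset_of_conn hD.conn hD.subset hx (hsS (hVs x (hDW x hx).1 z h hxz)) hyD
    rw [this]; exact hS.conn

end Attachments

section Paths

variable {α : Type*} {G : SimpleGraph α}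

/-- `k 0, …, k m` is an induced path of `G`. -/
def IsInducedPath (G : SimpleGraph α) (m : ℕ) (k : ℕ → α) : Prop :=
  ∀ i j, i < j → j ≤ m → k i ≠ k j ∧ (G.Adj (k i) (k j) ↔ j = i + 1)

lemma Conn.exists_isInducedPath {K : Set α} (cK : Conn G K) {t w : α} (ht : t ∈ K) (hw : w ∈ K) :
    ∃ m k, k 0 = t ∧ k m = w ∧ (∀ i, k i ∈ K) ∧ IsInducedPath G m k := by
  have hc : (G.induce K).Connected := cK
  obtain ⟨p, hp⟩ := hc.exists_walk_length_eq_dist ⟨t, ht⟩ ⟨w, hw⟩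
  refine ⟨p.length, fun i => (p.getVert i).1, by simp, by simp, fun i => (p.getVert i).2, ?_⟩
  intro i j hij hj
  have h₁ : (G.induce K).dist ⟨t, ht⟩ (p.getVert i) ≤ i :=
    (dist_le (p.take i)).trans (by simp)
  have h₂ : (G.induce K).dist (p.getVert j) ⟨w, hw⟩ ≤ p.length - j :=
    (dist_le (p.drop j)).trans (by simp)
  have h₃ := hc.dist_triangle (u := ⟨t, ht⟩) (v := p.getVert i) (w := ⟨w, hw⟩)
  have h₄ := hc.dist_triangle (u := p.getVert i) (v := p.getVert j) (w := ⟨w, hw⟩)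
  refine ⟨fun h => ?_, fun h => ?_, ?_⟩
  · rw [Subtype.ext h, dist_self] at h₄
    rw [Subtype.ext h] at h₃
    rw [Subtype.ext h] at h₁
    omega
  · have : (G.induce K).dist (p.getVert i) (p.getVert j) = 1 :=
      dist_eq_one_iff_adj.2 (by simpa using h)
    omega
  · rintro rfl
    have := p.adj_getVert_succ (i := i) (by omega)
    simpa using this

lemma IsInducedPath.conn_image_Icc {m : ℕ} {k : ℕ → α} (hk : IsInducedPath G m k) {a b : ℕ}
    (hab : a ≤ b) (hb : b ≤ m) : Conn G (k '' Set.Icc a b) := by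
  induction b, hab using Nat.le_induction with
  | base => simpa using conn_singleton (k a)
  | succ b hab ih =>
    have h := (ih (by omega)).union (conn_singleton (k (b + 1)))
      ⟨k b, ⟨b, ⟨hab, le_rfl⟩, rfl⟩, _, rfl, ((hk b (b + 1) (by omega) hb).2.2 rfl)⟩
    convert h using 1
    rw [← Set.image_singleton, ← Set.image_union]
    congr 1
    ext x
    simp only [Set.mem_Icc, Set.mem_union, Set.mem_singleton_iff]
    omega

lemma IsInducedPath.adj_iff {m : ℕ} {k : ℕ → α} (hk : IsInducedPath G m k) {i j : ℕ}
    (hi : i ≤ m) (hj : j ≤ m) : G.Adj (k i) (k j) ↔ i + 1 = j ∨ j + 1 = i := by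
  rcases lt_trichotomy i j with h | rfl | h
  · rw [(hk i j h hj).2]; omega
  · simp
  · rw [G.adj_comm, (hk j i h hi).2]; omega

lemma IsInducedPath.isBasicPath {m : ℕ} {k : ℕ → α} (hk : IsInducedPath G m k) {K : Set α}
    (hkK : ∀ i ≤ m, k i ∈ K) (hK : ∀ x ∈ K, ∃ i ≤ m, k i = x)
    (hN : ∀ i, 0 < i → i < m → ∀ y, G.Adj (k i) y → y ∈ K) : IsBasicPath G K := by
  have hinj : ∀ i j, i ≤ m → j ≤ m → k i = k j → i = j := by
    intro i j hi hj h
    rcases lt_trichotomy i j with h' | rfl | h'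
    exacts [((hk i j h' hj).1 h).elim, rfl, ((hk j i h' hi).1 h.symm).elim]
  let f : Fin (m + 1) → K := fun i => ⟨k i, hkK i (by omega)⟩
  have hf : Function.Bijective f := by
    constructor
    · intro i j h
      exact Fin.ext (hinj i j (by omega) (by omega) (congrArg Subtype.val h))
    · rintro ⟨x, hx⟩
      obtain ⟨i, hi, rfl⟩ := hK x hx
      exact ⟨⟨i, by omega⟩, rfl⟩
  let e : Fin (m + 1) ≃ K := Equiv.ofBijective f hf
  let φ : pathGraph (m + 1) ≃g G.induce K :=
    { toEquiv := e
      map_rel_iff' := by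
        intro i j
        change G.Adj (k i) (k j) ↔ _
        rw [hk.adj_iff (by omega) (by omega), pathGraph_adj] }
  refine ⟨m + 1, φ.symm, ?_⟩
  intro v h₀ hm
  obtain ⟨⟨i, hi⟩, rfl⟩ := φ.surjective v
  rw [RelIso.symm_apply_apply] at h₀ hm
  simp only [Nat.add_sub_cancel] at h₀ hm
  have : G.neighborSet (φ ⟨i, hi⟩).1 = {k (i - 1), k (i + 1)} := by
    change G.neighborSet (k i) = _
    ext y
    simp only [mem_neighborSet, Set.mem_insert_iff, Set.mem_singleton_iff]
    constructor
    · intro h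
      obtain ⟨j, hj, rfl⟩ := hK y (hN i (by omega) (by omega) y h)
      rcases (hk.adj_iff (by omega) hj).1 h with h | h
      · right; rw [h]
      · left; rw [← h]; rfl
    · rintro (rfl | rfl)
      · exact (hk.adj_iff (by omega) (by omega)).2 (by omega)
      · exact (hk.adj_iff (by omega) (by omega)).2 (by omega)
  rw [this]
  exact Set.ncard_pair (hk (i - 1) (i + 1) (by omega) (by omega)).1

/-- A connected set `K` attached only to `u` and `v` is complete to one of them or a basic path,
provided `u` and `v` are linked by a path bag `Z` and by a further bag `R`. -/
lemma complete_or_isBasicPath [Fintype α] (h2 : TwoConnected G) (hg : ¬ IsInducedMinor gem G)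
    {u v : α} (huv : u ≠ v) {R Z K : Set α} (cuZ : Conn G ({u} ∪ Z)) (cvZ : Conn G ({v} ∪ Z))
    (tuvZ : Touch G {u} ({v} ∪ Z)) (tvuZ : Touch G {v} ({u} ∪ Z)) (cR : Conn G R)
    (tRu : Touch G R {u}) (tRv : Touch G R {v}) (cK : Conn G K)
    (hN : ∀ x ∈ K, ∀ y, G.Adj x y → y ∈ K ∨ y = u ∨ y = v)
    (tKu : Touch G K {u}) (tKv : Touch G K {v})
    (huR : u ∉ R) (huZ : u ∉ Z) (huK : u ∉ K) (hvR : v ∉ R) (hvZ : v ∉ Z) (hvK : v ∉ K)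
    (dRZ : ∀ x ∈ R, x ∉ Z) (dRK : ∀ x ∈ R, x ∉ K) (dZK : ∀ x ∈ Z, x ∉ K) :
    (∀ x ∈ K, G.Adj u x) ∨ (∀ x ∈ K, G.Adj v x) ∨ IsBasicPath G K := by
  by_contra! hcon
  obtain ⟨⟨s, hs, hus⟩, ⟨s', hs', hvs'⟩, hb⟩ := hcon
  have nRK : ¬ Touch G R K := by
    rintro ⟨x, hx, y, hy, hxy⟩
    rcases hN y hy x hxy.symm with h | rfl | rfl
    exacts [dRK x hx h, huR hx, hvR hx]
  obtain ⟨t, ht, hut, -, -⟩ := exists_unique_attachment h2 hg cR cvZ cK huR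
    (by simp [huv, huZ]) huK (by rintro x hx (rfl | h); exacts [hvR hx, dRZ x hx h]) dRK
    (by rintro x (rfl | h); exacts [hvK, dZK x h]) tRu
    (tRv.mono le_rfl Set.subset_union_left) nRK tuvZ (by grind) tKu hs hus
  obtain ⟨w, hw, hvw, -, -⟩ := exists_unique_attachment h2 hg cR cuZ cK hvR
    (by simp [huv.symm, hvZ]) hvK (by rintro x hx (rfl | h); exacts [huR hx, dRZ x hx h]) dRK
    (by rintro x (rfl | h); exacts [huK, dZK x h]) tRv
    (tRu.mono le_rfl Set.subset_union_left) nRK tvuZ (by grind) tKv hs' hvs'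
  obtain ⟨m, k, rfl, rfl, hkK, hk⟩ := cK.exists_isInducedPath ht hw
  refine hb (hk.isBasicPath (fun i _ => hkK i) ?_ ?_)
  · by_contra! hcon
    obtain ⟨z, hz, hzk⟩ := hcon
    obtain ⟨W, hW, hzW⟩ := exists_isComp G (M := K \ (k '' Set.Icc 0 m)) (x := z)
      ⟨hz, by rintro ⟨i, hi, h⟩; exact hzk i hi.2 h⟩
    have hWK : ∀ x ∈ W, x ∈ K ∧ ∀ i ≤ m, k i ≠ x := fun x hx =>
      ⟨(hW.subset hx).1, fun i hi h => (hW.subset hx).2 ⟨i, ⟨Nat.zero_le i, hi⟩, h⟩⟩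
    have hkW : ∀ i ≤ m, k i ∉ W := fun i hi h => (hWK _ h).2 i hi rfl
    have hWu : ∀ x ∈ W, ¬ G.Adj u x := fun x hx h =>
      (hWK x hx).2 0 (Nat.zero_le m) ((hut x (hWK x hx).1).1 h).symm
    have hWv : ∀ x ∈ W, ¬ G.Adj v x := fun x hx h =>
      (hWK x hx).2 m le_rfl ((hvw x (hWK x hx).1).1 h).symm
    have hWN : ∀ x ∈ W, ∀ y, y ∉ W → G.Adj x y → ∃ i ≤ m, k i = y := by
      intro x hx y hyW hxy
      rcases hN x (hWK x hx).1 y hxy with h | rfl | rfl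
      · by_contra! hc
        exact hyW (hW.mem_of_adj hx ⟨h, by rintro ⟨i, hi, h⟩; exact hc i hi.2 h⟩ hxy)
      · exact (hWu x hx hxy.symm).elim
      · exact (hWv x hx hxy.symm).elim
    have huW : u ∉ W := fun h => huK (hWK u h).1
    have hvW : v ∉ W := fun h => hvK (hWK v h).1
    obtain ⟨x₁, hx₁, y₁, hy₁, -, hxy₁⟩ := h2.exists_adj hzW huW hvW huv.symm
    obtain ⟨a, ha, rfl⟩ := hWN x₁ hx₁ y₁ hy₁ hxy₁
    obtain ⟨x₂, hx₂, y₂, hy₂, hne, hxy₂⟩ := h2.exists_adj hzW hy₁ huW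
      (by rintro rfl; exact huK (hkK a))
    obtain ⟨b, hb, rfl⟩ := hWN x₂ hx₂ y₂ hy₂ hxy₂
    have hab : a ≠ b := by rintro rfl; exact hne rfl
    obtain ⟨i, j, x, y, hij, hj, hx, hxi, hy, hyj⟩ : ∃ i j x y, i < j ∧ j ≤ m ∧ x ∈ W ∧
        G.Adj x (k i) ∧ y ∈ W ∧ G.Adj y (k j) := by
      rcases lt_or_gt_of_ne hab with h | h
      · exact ⟨a, b, x₁, x₂, h, hb, hx₁, hxy₁, hx₂, hxy₂⟩
      · exact ⟨b, a, x₂, x₁, h, ha, hx₂, hxy₂, hx₁, hxy₁⟩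
    have huk : G.Adj u (k 0) := (hut _ (hkK 0)).2 rfl
    have hvk : G.Adj v (k m) := (hvw _ (hkK m)).2 rfl
    have nWR : ¬ Touch G W R := fun h => nRK (h.symm.mono le_rfl (fun x hx => (hWK x hx).1))
    have hkR : ∀ i, k i ∉ R := fun i h => dRK _ h (hkK i)
    have hkZ : ∀ i, k i ∉ Z := fun i h => dZK _ h (hkK i)
    have hku : ∀ i, k i ≠ u := fun i h => huK (h ▸ hkK i)
    have hkv : ∀ i, k i ≠ v := fun i h => hvK (h ▸ hkK i)
    have cH : Conn G ({u} ∪ k '' Set.Icc 0 (j - 1)) :=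
      (conn_singleton u).union (hk.conn_image_Icc (Nat.zero_le _) (by omega))
        ⟨u, rfl, k 0, ⟨0, by simp, rfl⟩, huk⟩
    refine hg (gem_of cH hW.conn (hk.conn_image_Icc hj le_rfl) cvZ cR ?_
      ⟨k i, Or.inr ⟨i, ⟨Nat.zero_le _, by omega⟩, rfl⟩, x, hx, hxi.symm⟩
      ⟨k (j - 1), Or.inr ⟨j - 1, by simp, rfl⟩, k j, ⟨j, by simpa using hj, rfl⟩,
        (hk.adj_iff (by omega) hj).2 (by omega)⟩
      (tuvZ.mono Set.subset_union_left le_rfl) (tRu.symm.mono Set.subset_union_left le_rfl)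
      ⟨y, hy, k j, ⟨j, by simpa using hj, rfl⟩, hyj⟩
      ⟨k m, ⟨m, by simpa using hj, rfl⟩, v, Or.inl rfl, hvk.symm⟩
      (tRv.symm.mono Set.subset_union_left le_rfl) ?_ nWR ?_)
    · refine ⟨?_, ?_, ?_, ?_⟩
      · rintro a (rfl | ⟨l, hl, rfl⟩)
        · refine ⟨huW, ?_, by simp [huv, huZ], huR⟩
          rintro ⟨l, -, h⟩; exact hku l h
        · have hl' : l ≤ j - 1 := hl.2
          refine ⟨hkW l (by omega), ?_, ?_, hkR l⟩
          · rintro ⟨l', hl'', h⟩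
            have : j ≤ l' ∧ l' ≤ m := hl''
            exact (hk l l' (by omega) this.2).1 h.symm
          · rintro (h | h)
            exacts [hkv l h, hkZ l h]
      · intro a ha
        refine ⟨?_, ?_, fun h => dRK a h (hWK a ha).1⟩
        · rintro ⟨l, hl, rfl⟩; exact hkW l hl.2 ha
        · rintro (rfl | h)
          exacts [hvW ha, dZK a h (hWK a ha).1]
      · rintro - ⟨l, hl, rfl⟩
        exact ⟨by rintro (h | h); exacts [hkv l h, hkZ l h], hkR l⟩
      · rintro a (rfl | h) h'
        exacts [hvR h', dRZ a h' h]
    · rintro ⟨a, ha, b, rfl | hb, hab⟩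
      · exact hWv a ha hab.symm
      · rcases hN a (hWK a ha).1 b hab with h | rfl | rfl
        exacts [dZK b hb h, huZ hb, hvZ hb]
    · rintro ⟨-, ⟨l, -, rfl⟩, b, hb, hab⟩
      exact nRK ⟨b, hb, k l, hkK l, hab.symm⟩
  · intro i hi him y hy
    rcases hN _ (hkK i) y hy with h | rfl | rfl
    · exact h
    · exact ((hk 0 i hi him.le).1 ((hut _ (hkK i)).1 hy.symm).symm).elim
    · exact ((hk i m him le_rfl).1 ((hvw _ (hkK i)).1 hy.symm)).elim

end Paths

section CommonNeighbour

variable {α : Type*} {G : SimpleGraph α}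

lemma IsComp.eq_of_mem {M K L : Set α} (hK : IsComp G M K) (hL : IsComp G M L) {x : α}
    (hx : x ∈ K) (hx' : x ∈ L) : K = L :=
  (hL.subset_of_conn hK.conn hK.subset hx hx').antisymm
    (hK.subset_of_conn hL.conn hL.subset hx' hx)

lemma IsComp.eq_of_touch {M K L : Set α} (hK : IsComp G M K) (hL : IsComp G M L)
    (h : Touch G K L) : K = L := by
  obtain ⟨x, hx, y, hy, h⟩ := h
  exact hK.eq_of_mem hL (hK.mem_of_adj hx (hL.subset hy) h) hy

/-- A connected set meeting two disjoint sets contains a connected set meeting both of them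
exactly once. -/
lemma Conn.exists_linking [Finite α] {K : Set α} (cK : Conn G K) {p q : α → Prop}
    (hp : ∃ x ∈ K, p x) (hq : ∃ x ∈ K, q x) (hpq : ∀ x ∈ K, p x → ¬ q x) :
    ∃ Z ⊆ K, Conn G Z ∧ ∃ t ∈ Z, ∃ w ∈ Z, p t ∧ q w ∧ (∀ x ∈ Z, p x → x = t) ∧
      (∀ x ∈ Z, q x → x = w) := by
  have key : ∀ (p q : α → Prop) (Z : Set α), Conn G Z →
      (∀ Y ⊆ Z, Conn G Y → (∃ x ∈ Y, p x) → (∃ x ∈ Y, q x) → Z ⊆ Y) →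
      ∀ t ∈ Z, p t → ∀ w ∈ Z, q w → ¬ p w → ∀ x ∈ Z, p x → x = t := by
    intro p q Z cZ hmin t ht hpt w hw hqw hpw x hx hpx
    by_contra hxt
    obtain ⟨B, hB, hwB⟩ := exists_isComp G (M := Z \ {t}) (x := w)
      ⟨hw, by rintro rfl; exact hpw hpt⟩
    have hBZ : B ⊆ Z := fun y hy => (hB.subset hy).1
    have hxB : x ∉ B := fun h =>
      (hB.subset (hmin B hBZ hB.conn ⟨x, h, hpx⟩ ⟨w, hwB, hqw⟩ ht)).2 rfl
    have cBt : Conn G (B ∪ {t}) := hB.conn.union (conn_singleton t)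
      (hB.touch_of_conn cZ (Set.singleton_nonempty t) (by simpa using ht))
    have := hmin (B ∪ {t}) (Set.union_subset hBZ (by simpa using ht)) cBt
      ⟨t, Or.inr rfl, hpt⟩ ⟨w, Or.inl hwB, hqw⟩ hx
    exact this.elim hxB hxt
  obtain ⟨Z, -, ⟨⟨hZK, cZ, ⟨t, ht, hpt⟩, w, hw, hqw⟩, hmin⟩⟩ :=
    exists_minimal_le_of_wellFoundedLT
      (fun Y => Y ⊆ K ∧ Conn G Y ∧ (∃ x ∈ Y, p x) ∧ ∃ x ∈ Y, q x) K ⟨le_rfl, cK, hp, hq⟩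
  refine ⟨Z, hZK, cZ, t, ht, w, hw, hpt, hqw, ?_, ?_⟩
  · exact key p q Z cZ (fun Y hY cY h h' => hmin ⟨hY.trans hZK, cY, h, h'⟩ hY) t ht hpt w hw hqw
      (fun h => hpq w (hZK hw) h hqw)
  · exact key q p Z cZ (fun Y hY cY h h' => hmin ⟨hY.trans hZK, cY, h', h⟩ hY) w hw hqw t ht hpt
      (hpq t (hZK ht) hpt)

lemma exists_comp_touching_both (hg : ¬ IsInducedMinor gem G) {u v : α} (huv : u ≠ v)
    {R K Z : Set α} (cR : Conn G R) (cK : Conn G K)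
    (huR : u ∉ R) (huK : u ∉ K) (hvR : v ∉ R) (hvK : v ∉ K) (dRK : ∀ x ∈ R, x ∉ K)
    (nRK : ¬ Touch G R K) (tRu : Touch G R {u}) (tRv : Touch G R {v})
    (cZ : Conn G Z) (hZK : Z ⊆ K) (tZu : Touch G Z {u}) (tZv : Touch G Z {v})
    (hu : ∃ x ∈ K, x ∉ Z ∧ G.Adj u x) (hv : ∃ x ∈ K, x ∉ Z ∧ G.Adj v x) :
    ∃ W, IsComp G (K \ Z) W ∧ Touch G W {u} ∧ Touch G W {v} := by
  obtain ⟨t, htK, htZ, hut⟩ := hu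
  obtain ⟨w, hwK, hwZ, hvw⟩ := hv
  obtain ⟨P, hP, htP⟩ := exists_isComp G (M := K \ Z) ⟨htK, htZ⟩
  obtain ⟨Q, hQ, hwQ⟩ := exists_isComp G (M := K \ Z) ⟨hwK, hwZ⟩
  have tPu : Touch G P {u} := ⟨t, htP, u, rfl, hut.symm⟩
  have tQv : Touch G Q {v} := ⟨w, hwQ, v, rfl, hvw.symm⟩
  by_contra! hcon
  have nPv := hcon P hP tPu
  have nQu : ¬ Touch G Q {u} := fun h => hcon Q hQ h tQv
  have hne : P ≠ Q := by rintro rfl; exact nPv tQv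
  have hPQ : ∀ x ∈ P, x ∉ Q := fun x hx hx' => hne (hP.eq_of_mem hQ hx hx')
  have nPQ : ¬ Touch G P Q := fun h => hne (hP.eq_of_touch hQ h)
  have hPK : ∀ x ∈ P, x ∈ K ∧ x ∉ Z := fun x hx => hP.subset hx
  have hQK : ∀ x ∈ Q, x ∈ K ∧ x ∉ Z := fun x hx => hQ.subset hx
  refine hg (gem_of cZ hP.conn ((conn_singleton u).union cR tRu.symm) (conn_singleton v) hQ.conn
    ?_ (hP.touch_of_conn cK cZ.nonempty hZK).symm (tZu.mono le_rfl Set.subset_union_left) tZv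
    (hQ.touch_of_conn cK cZ.nonempty hZK).symm (tPu.mono le_rfl Set.subset_union_left)
    (tRv.mono Set.subset_union_right le_rfl) tQv.symm nPv nPQ ?_)
  · grind
  · rintro ⟨x, rfl | hx, y, hy, hxy⟩
    · exact nQu ⟨y, hy, x, rfl, hxy.symm⟩
    · exact nRK ⟨x, hx, y, (hQK y hy).1, hxy⟩

lemma exists_common_neighbour [Fintype α] (hg : ¬ IsInducedMinor gem G)
    {u v : α} (huv : u ≠ v) {R K : Set α} (cR : Conn G R) (cK : Conn G K)
    (huR : u ∉ R) (huK : u ∉ K) (hvR : v ∉ R) (hvK : v ∉ K) (dRK : ∀ x ∈ R, x ∉ K)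
    (nRK : ¬ Touch G R K) (tRu : Touch G R {u}) (tRv : Touch G R {v})
    (hu : ∃ x ∈ K, ∃ y ∈ K, x ≠ y ∧ G.Adj u x ∧ G.Adj u y)
    (hv : ∃ x ∈ K, ∃ y ∈ K, x ≠ y ∧ G.Adj v x ∧ G.Adj v y) :
    ∃ c ∈ K, G.Adj u c ∧ G.Adj v c := by
  by_contra! hcon
  obtain ⟨Z, hZK, cZ, t, ht, w, hw, hut, hvw, hut', hvw'⟩ :=
    cK.exists_linking (p := G.Adj u) (q := G.Adj v) (by grind) (by grind) hcon
  have htw : t ≠ w := by rintro rfl; exact hcon t (hZK ht) hut hvw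
  obtain ⟨W, hW, tWu, tWv⟩ := exists_comp_touching_both hg huv cR cK huR huK hvR hvK dRK nRK
    tRu tRv cZ hZK ⟨t, ht, u, rfl, hut.symm⟩ ⟨w, hw, v, rfl, hvw.symm⟩ (by grind) (by grind)
  have hWK : ∀ x ∈ W, x ∈ K ∧ x ∉ Z := fun x hx => hW.subset hx
  obtain ⟨B, hB, hwB⟩ := exists_isComp G (M := Z \ {t}) (x := w) ⟨hw, htw.symm⟩
  have hBZ : ∀ x ∈ B, x ∈ Z ∧ x ≠ t := fun x hx => hB.subset hx
  have htA : t ∈ Z \ B := ⟨ht, fun h => (hBZ t h).2 rfl⟩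
  have cA := hB.conn_diff cZ (conn_singleton t) (by simpa using ht)
  by_cases hWB : Touch G W B
  · refine hg (gem_of ((conn_singleton u).union hW.conn tWu.symm) cR (conn_singleton v) hB.conn cA
      ?_ (tRu.symm.mono Set.subset_union_left le_rfl) (tWv.mono Set.subset_union_right le_rfl)
      (hWB.mono Set.subset_union_right le_rfl) ⟨u, Or.inl rfl, t, htA, hut⟩ tRv
      ⟨v, rfl, w, hwB, hvw⟩ ?_ ?_ ?_ ?_)
    · grind
    · exact (hB.touch_of_conn cZ (Set.singleton_nonempty t) (by simpa using ht)).mono le_rfl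
        (by simpa using htA)
    · exact fun h => nRK (h.mono le_rfl (fun x hx => hZK (hBZ x hx).1))
    · exact fun h => nRK (h.mono le_rfl (fun x hx => hZK hx.1))
    · rintro ⟨x, rfl, y, hy, hxy⟩
      exact hy.2 (hvw' y hy.1 hxy ▸ hwB)
  · obtain ⟨A, hA, hBA⟩ := exists_isComp_of_conn (M := Z \ {w}) cA
      (fun x hx => ⟨hx.1, by rintro rfl; exact hx.2 hwB⟩)
    have hAZ : ∀ x ∈ A, x ∈ Z ∧ x ≠ w := fun x hx => hA.subset hx
    have hwA : w ∈ Z \ A := ⟨hw, fun h => (hAZ w h).2 rfl⟩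
    have cD := hA.conn_diff cZ (conn_singleton w) (by simpa using hw)
    have hWA : Touch G W A := by
      obtain ⟨x, hx, y, hy, hxy⟩ := hW.touch_of_conn cK cZ.nonempty hZK
      exact ⟨x, hx, y, hBA ⟨hy, fun h => hWB ⟨x, hx, y, h, hxy⟩⟩, hxy⟩
    refine hg (gem_of ((conn_singleton v).union hW.conn tWv.symm) cR (conn_singleton u) hA.conn cD
      ?_ (tRv.symm.mono Set.subset_union_left le_rfl) (tWu.mono Set.subset_union_right le_rfl)
      (hWA.mono Set.subset_union_right le_rfl) ⟨v, Or.inl rfl, w, hwA, hvw⟩ tRu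
      ⟨u, rfl, t, hBA htA, hut⟩ ?_ ?_ ?_ ?_)
    · grind
    · exact (hA.touch_of_conn cZ (Set.singleton_nonempty w) (by simpa using hw)).mono le_rfl
        (by simpa using hwA)
    · exact fun h => nRK (h.mono le_rfl (fun x hx => hZK (hAZ x hx).1))
    · exact fun h => nRK (h.mono le_rfl (fun x hx => hZK hx.1))
    · rintro ⟨x, rfl, y, hy, hxy⟩
      exact hy.2 (hut' y hy.1 hxy ▸ hBA htA)

lemma not_touch_of_attached {u v : α} {R K : Set α} (huR : u ∉ R) (hvR : v ∉ R)
    (dRK : ∀ x ∈ R, x ∉ K) (hN : ∀ x ∈ K, ∀ y, G.Adj x y → y ∈ K ∨ y = u ∨ y = v) :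
    ¬ Touch G R K := by
  rintro ⟨x, hx, y, hy, hxy⟩
  rcases hN y hy x hxy.symm with h | rfl | rfl
  exacts [dRK x hx h, huR hx, hvR hx]

/-- If `K` is attached only to the nonadjacent vertices `u` and `v`, each having at least two
neighbours in `K`, then `u` is complete to `K`, and `u`, `v` have a common neighbour in `K`
touching a connected subset of `K` that touches both `u` and `v`. -/
lemma complete_of_two_attachments [Fintype α] (h2 : TwoConnected G) (hg : ¬ IsInducedMinor gem G)
    {u v : α} (huv : u ≠ v) (nuv : ¬ G.Adj u v) {R K : Set α} (cR : Conn G R) (cK : Conn G K)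
    (huR : u ∉ R) (huK : u ∉ K) (hvR : v ∉ R) (hvK : v ∉ K) (dRK : ∀ x ∈ R, x ∉ K)
    (hN : ∀ x ∈ K, ∀ y, G.Adj x y → y ∈ K ∨ y = u ∨ y = v)
    (tRu : Touch G R {u}) (tRv : Touch G R {v})
    (hu : ∃ x ∈ K, ∃ y ∈ K, x ≠ y ∧ G.Adj u x ∧ G.Adj u y)
    (hv : ∃ x ∈ K, ∃ y ∈ K, x ≠ y ∧ G.Adj v x ∧ G.Adj v y) :
    (∀ x ∈ K, G.Adj u x) ∧ ∃ c ∈ K, G.Adj u c ∧ G.Adj v c ∧ ∃ W ⊆ K, c ∉ W ∧ Conn G W ∧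
      Touch G W {u} ∧ Touch G W {v} ∧ Touch G W {c} := by
  have nRK := not_touch_of_attached huR hvR dRK hN
  obtain ⟨c, hc, huc, hvc⟩ := exists_common_neighbour hg huv cR cK huR huK hvR hvK dRK nRK tRu tRv
    hu hv
  have hcK : {c} ⊆ K := by simpa using hc
  obtain ⟨W₀, hW₀, tW₀u, tW₀v⟩ := exists_comp_touching_both hg huv cR cK huR huK hvR hvK dRK nRK
    tRu tRv (conn_singleton c) hcK ⟨c, rfl, u, rfl, huc.symm⟩ ⟨c, rfl, v, rfl, hvc.symm⟩
    (by grind) (by grind)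
  have hcomp : ∀ W, IsComp G (K \ {c}) W → ∀ x ∈ W, x ∈ K ∧ x ≠ c := fun W hW x hx => hW.subset hx
  have htc : ∀ W, IsComp G (K \ {c}) W → Touch G W {c} := fun W hW =>
    hW.touch_of_conn cK (Set.singleton_nonempty c) hcK
  have hWN : ∀ W, IsComp G (K \ {c}) W → ∀ x ∈ W, ∀ y, G.Adj x y →
      y ∈ W ∨ y = u ∨ y ∈ ({v} ∪ {c} : Set α) := by
    intro W hW x hx y hxy
    by_cases hyc : y = c
    · exact Or.inr (Or.inr (Or.inr hyc))
    rcases hN x (hcomp W hW x hx).1 y hxy with h | h | h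
    exacts [Or.inl (hW.mem_of_adj hx ⟨h, hyc⟩ hxy), Or.inr (Or.inl h), Or.inr (Or.inr (Or.inl h))]
  have huc' : u ≠ c := huc.ne
  have hvc' : v ≠ c := hvc.ne
  have hboth : ∀ W, IsComp G (K \ {c}) W → Touch G W {u} ∧ Touch G W {v} := by
    intro W hW
    have hWK := hcomp W hW
    have hW₀K := hcomp W₀ hW₀
    obtain ⟨x₀, hx₀⟩ := hW.conn.nonempty
    obtain ⟨x, hx, y, hyW, hyc, hxy⟩ := h2.exists_adj hx₀ (fun h => (hWK c h).2 rfl)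
      (fun h => huK (hWK u h).1) huc'
    have huv' : Touch G W {u} ∨ Touch G W {v} := by
      rcases hWN W hW x hx y hxy with h | h | h | h
      · exact (hyW h).elim
      · exact Or.inl ⟨x, hx, y, h, hxy⟩
      · exact Or.inr ⟨x, hx, y, h, hxy⟩
      · exact (hyc h).elim
    by_contra hnot
    have hne : W ≠ W₀ := by rintro rfl; exact hnot ⟨tW₀u, tW₀v⟩
    have hdis : ∀ x ∈ W, x ∉ W₀ := fun x hx hx' => hne (hW.eq_of_mem hW₀ hx hx')
    have nWW₀ : ¬ Touch G W W₀ := fun h => hne (hW.eq_of_touch hW₀ h)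
    have nuv' : ¬ Touch G {u} {v} := by simpa [Touch] using nuv
    rcases huv' with h | h
    · refine hg (gem_of (conn_singleton c) hW.conn (conn_singleton u) hW₀.conn (conn_singleton v)
        (by grind) (htc W hW).symm ⟨c, rfl, u, rfl, huc.symm⟩ (htc W₀ hW₀).symm
        ⟨c, rfl, v, rfl, hvc.symm⟩ h tW₀u.symm tW₀v nWW₀ (fun h' => hnot ⟨h, h'⟩) nuv')
    · refine hg (gem_of (conn_singleton c) hW.conn (conn_singleton v) hW₀.conn (conn_singleton u)
        (by grind) (htc W hW).symm ⟨c, rfl, v, rfl, hvc.symm⟩ (htc W₀ hW₀).symm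
        ⟨c, rfl, u, rfl, huc.symm⟩ h tW₀v.symm tW₀u nWW₀ (fun h' => hnot ⟨h', h⟩)
        (fun h => nuv' h.symm))
  have hcompl : ∀ W, IsComp G (K \ {c}) W → ∀ x ∈ W, G.Adj u x := by
    intro W hW s hs
    by_contra hus
    have hWK := hcomp W hW
    have nRW : ¬ Touch G R W := fun h => nRK (h.mono le_rfl (fun x hx => (hWK x hx).1))
    obtain ⟨t, ht, hut, htV, cD⟩ := exists_unique_attachment h2 hg (V := {v} ∪ {c}) cR
      ((conn_singleton v).union (conn_singleton c) ⟨v, rfl, c, rfl, hvc⟩) hW.conn huR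
      (by grind) (by grind) (by grind) (by grind) (by grind) tRu
      (tRv.mono le_rfl Set.subset_union_left) nRW ⟨u, rfl, c, Or.inr rfl, huc⟩ (hWN W hW)
      (hboth W hW).1 hs hus
    have hnt : ∀ y, y = v ∨ y = c → ¬ G.Adj t y := fun y hy h => htV ⟨t, rfl, y, hy, h⟩
    have huct : Touch G ({u} ∪ {c}) {t} := ⟨u, Or.inl rfl, t, rfl, (hut t ht).2 rfl⟩
    obtain ⟨x₁, hx₁, hx₁c⟩ := touch_singleton_right.1 (htc W hW)
    obtain ⟨x₂, hx₂, hx₂v⟩ := touch_singleton_right.1 (hboth W hW).2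
    have hx₁t : x₁ ≠ t := by rintro rfl; exact hnt c (Or.inr rfl) hx₁c
    have hx₂t : x₂ ≠ t := by rintro rfl; exact hnt v (Or.inl rfl) hx₂v
    obtain ⟨a, ha, hat, b, hb, hbt, hab⟩ := hW.conn.exists_adj (B := {t}) ht rfl hx₁ hx₁t
    refine hg (gem_of ((conn_singleton u).union (conn_singleton c) ⟨u, rfl, c, rfl, huc⟩) cR
      (conn_singleton v) cD (conn_singleton t) (by grind)
      (tRu.symm.mono Set.subset_union_left le_rfl) ⟨c, Or.inr rfl, v, rfl, hvc.symm⟩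
      ⟨c, Or.inr rfl, x₁, ⟨hx₁, hx₁t⟩, hx₁c.symm⟩ huct tRv ⟨v, rfl, x₂, ⟨hx₂, hx₂t⟩, hx₂v.symm⟩
      ⟨b, ⟨hb, hbt⟩, a, hat, hab.symm⟩ (fun h => nRW (h.mono le_rfl (fun x hx => hx.1)))
      (fun h => nRW (h.mono le_rfl (by simpa using ht))) ?_)
    simp only [Touch, Set.mem_singleton_iff, exists_eq_left]
    exact fun h => hnt v (Or.inl rfl) h.symm
  refine ⟨fun x hx => ?_, c, hc, huc, hvc, W₀, fun x hx => (hcomp W₀ hW₀ x hx).1,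
    fun h => (hcomp W₀ hW₀ c h).2 rfl, hW₀.conn, tW₀u, tW₀v, htc W₀ hW₀⟩
  by_cases hxc : x = c
  · exact hxc ▸ huc
  · obtain ⟨W, hW, hxW⟩ := exists_isComp G (M := K \ {c}) (x := x) ⟨hx, hxc⟩
    exact hcompl W hW x hxW

end CommonNeighbour

section Separations

variable {α : Type*} {G : SimpleGraph α}

/-- `K` induces a cograph or a basic path. -/
def IsCographOrPath (G : SimpleGraph α) (K : Set α) : Prop :=
  IsCograph (G.induce K) ∨ IsBasicPath G K

lemma isCograph_of_complete (hg : ¬ IsInducedMinor gem G) {u : α} {K : Set α}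
    (h : ∀ x ∈ K, G.Adj u x) : IsCograph (G.induce K) := by
  intro f hf hadj
  have hne : ∀ i, (f i).1 ≠ u := fun i hi => (h _ (f i).2).ne hi.symm
  have hinj : ∀ i j, i ≠ j → (f i).1 ≠ (f j).1 := fun i j hij h => hij (hf (Subtype.ext h))
  have ht : ∀ i j, Touch G {(f i).1} {(f j).1} ↔ (pathGraph 4).Adj i j := by
    intro i j
    rw [← hadj]
    simp [Touch]
  have hu : ∀ i, Touch G {u} {(f i).1} := fun i => ⟨u, rfl, _, rfl, h _ (f i).2⟩
  refine hg (gem_of (conn_singleton u) (conn_singleton (f 0).1) (conn_singleton (f 1).1)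
    (conn_singleton (f 2).1) (conn_singleton (f 3).1) ?_ (hu 0) (hu 1) (hu 2) (hu 3) ?_ ?_ ?_ ?_ ?_
    ?_)
  · have h₁ := hinj 0 1 (by decide)
    have h₂ := hinj 0 2 (by decide)
    have h₃ := hinj 0 3 (by decide)
    have h₄ := hinj 1 2 (by decide)
    have h₅ := hinj 1 3 (by decide)
    have h₆ := hinj 2 3 (by decide)
    simp only [Set.mem_singleton_iff, forall_eq]
    exact ⟨⟨(hne 0).symm, (hne 1).symm, (hne 2).symm, (hne 3).symm⟩, ⟨h₁, h₂, h₃⟩, ⟨h₄, h₅⟩, h₆⟩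
  all_goals
    rw [ht, pathGraph_adj]
    decide

lemma isComp_image_supp {M : Set α} (K : (G.induce M).ConnectedComponent) :
    IsComp G M (Subtype.val '' K.supp) := by
  refine ⟨by rintro - ⟨x, -, rfl⟩; exact x.2, ?_, ?_⟩
  · rw [conn_iff]
    refine ⟨K.nonempty_supp.image _, ?_⟩
    rintro B hB ⟨b, hb⟩ hcl - ⟨a, ha, rfl⟩
    obtain ⟨b, hbK, rfl⟩ := hB hb
    obtain ⟨w⟩ := ConnectedComponent.exact (hbK.trans ha.symm)
    suffices ∀ p q : M, (G.induce M).Walk p q → p ∈ K.supp → p.1 ∈ B → q.1 ∈ B from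
      this _ _ w hbK hb
    intro p q w
    induction w with
    | nil => exact fun _ h => h
    | cons hadj _ ih =>
      intro hp hpB
      have := (K.mem_supp_congr_adj hadj).1 hp
      exact ih this (hcl _ hpB _ ⟨_, this, rfl⟩ hadj)
  · rintro - ⟨x, hx, rfl⟩ y hy hxy
    exact ⟨⟨y, hy⟩, (K.mem_supp_congr_adj (v := x) (w := ⟨y, hy⟩) hxy).1 hx, rfl⟩

lemma isComp_compl_pair {u v : α} {K : Set α} (cK : Conn G K) (huK : u ∉ K) (hvK : v ∉ K)
    (hN : ∀ x ∈ K, ∀ y, G.Adj x y → y ∈ K ∨ y = u ∨ y = v) :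
    IsComp G {x | x ≠ u ∧ x ≠ v} K := by
  refine ⟨fun x hx => ⟨?_, ?_⟩, cK, fun x hx y hy hxy => ?_⟩
  · rintro rfl; exact huK hx
  · rintro rfl; exact hvK hx
  · rcases hN x hx y hxy with h | h | h
    exacts [h, (hy.1 h).elim, (hy.2 h).elim]

section Pair

variable {u v : α} {K L : Set α}

lemma IsComp.left_notMem (hK : IsComp G {x | x ≠ u ∧ x ≠ v} K) : u ∉ K :=
  fun h => (hK.subset h).1 rfl

lemma IsComp.right_notMem (hK : IsComp G {x | x ≠ u ∧ x ≠ v} K) : v ∉ K :=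
  fun h => (hK.subset h).2 rfl

lemma IsComp.attached (hK : IsComp G {x | x ≠ u ∧ x ≠ v} K) :
    ∀ x ∈ K, ∀ y, G.Adj x y → y ∈ K ∨ y = u ∨ y = v := by
  intro x hx y hxy
  by_contra! h
  exact h.1 (hK.mem_of_adj hx h.2 hxy)

lemma IsComp.touch_left [Fintype α] (h2 : TwoConnected G) (huv : u ≠ v)
    (hK : IsComp G {x | x ≠ u ∧ x ≠ v} K) : Touch G K {u} := by
  obtain ⟨x₀, hx₀⟩ := hK.conn.nonempty
  obtain ⟨x, hx, y, hyK, hyv, hxy⟩ := h2.exists_adj hx₀ hK.right_notMem hK.left_notMem huv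
  exact ⟨x, hx, y, ((hK.attached x hx y hxy).resolve_left hyK).resolve_right hyv, hxy⟩

lemma IsComp.touch_right [Fintype α] (h2 : TwoConnected G) (huv : u ≠ v)
    (hK : IsComp G {x | x ≠ u ∧ x ≠ v} K) : Touch G K {v} := by
  obtain ⟨x₀, hx₀⟩ := hK.conn.nonempty
  obtain ⟨x, hx, y, hyK, hyu, hxy⟩ := h2.exists_adj hx₀ hK.left_notMem hK.right_notMem huv.symm
  exact ⟨x, hx, y, ((hK.attached x hx y hxy).resolve_left hyK).resolve_left hyu, hxy⟩

lemma IsComp.notMem_of_ne {M : Set α} (hK : IsComp G M K) (hL : IsComp G M L) (h : K ≠ L) :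
    ∀ x ∈ K, x ∉ L := fun _ hx hx' => h (hK.eq_of_mem hL hx hx')

lemma isCographOrPath_of_linked [Fintype α] (h2 : TwoConnected G) (hg : ¬ IsInducedMinor gem G)
    (huv : u ≠ v) {R Z : Set α} (hK : IsComp G {x | x ≠ u ∧ x ≠ v} K)
    (cuZ : Conn G ({u} ∪ Z)) (cvZ : Conn G ({v} ∪ Z))
    (tuvZ : Touch G {u} ({v} ∪ Z)) (tvuZ : Touch G {v} ({u} ∪ Z)) (cR : Conn G R)
    (tRu : Touch G R {u}) (tRv : Touch G R {v})
    (huR : u ∉ R) (huZ : u ∉ Z) (hvR : v ∉ R) (hvZ : v ∉ Z)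
    (dRZ : ∀ x ∈ R, x ∉ Z) (dRK : ∀ x ∈ R, x ∉ K) (dZK : ∀ x ∈ Z, x ∉ K) :
    IsCographOrPath G K := by
  rcases complete_or_isBasicPath h2 hg huv cuZ cvZ tuvZ tvuZ cR tRu tRv hK.conn hK.attached
    (hK.touch_left h2 huv) (hK.touch_right h2 huv) huR huZ hK.left_notMem hvR hvZ hK.right_notMem
    dRZ dRK dZK with h | h | h
  exacts [Or.inl (isCograph_of_complete hg h), Or.inl (isCograph_of_complete hg h), Or.inr h]

/-- Components of the complement of a pair `u, v` are fine as soon as `u, v` are adjacent or there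
are at least three components. -/
lemma IsComp.isCographOrPath [Fintype α] (h2 : TwoConnected G) (hg : ¬ IsInducedMinor gem G)
    (huv : u ≠ v) {R : Set α} (hK : IsComp G {x | x ≠ u ∧ x ≠ v} K)
    (hR : IsComp G {x | x ≠ u ∧ x ≠ v} R) (hRK : R ≠ K)
    (h : G.Adj u v ∨ ∃ Z, IsComp G {x | x ≠ u ∧ x ≠ v} Z ∧ Z ≠ K ∧ Z ≠ R) :
    IsCographOrPath G K := by
  rcases h with h | ⟨Z, hZ, hZK, hZR⟩
  · refine isCographOrPath_of_linked h2 hg huv (R := R) (Z := ∅) hK ?_ ?_ ?_ ?_ hR.conn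
      (hR.touch_left h2 huv) (hR.touch_right h2 huv) hR.left_notMem (by simp) hR.right_notMem
      (by simp) (by simp) (hR.notMem_of_ne hK hRK) (by simp)
    · simpa using conn_singleton u
    · simpa using conn_singleton v
    · exact ⟨u, rfl, v, Or.inl rfl, h⟩
    · exact ⟨v, rfl, u, Or.inl rfl, h.symm⟩
  · exact isCographOrPath_of_linked h2 hg huv (R := R) (Z := Z) hK
      ((conn_singleton u).union hZ.conn (hZ.touch_left h2 huv).symm)
      ((conn_singleton v).union hZ.conn (hZ.touch_right h2 huv).symm)
      ((hZ.touch_left h2 huv).symm.mono le_rfl Set.subset_union_right)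
      ((hZ.touch_right h2 huv).symm.mono le_rfl Set.subset_union_right) hR.conn
      (hR.touch_left h2 huv) (hR.touch_right h2 huv) hR.left_notMem hZ.left_notMem
      hR.right_notMem hZ.right_notMem (hR.notMem_of_ne hZ hZR.symm) (hR.notMem_of_ne hK hRK)
      (hZ.notMem_of_ne hK hZK)

end Pair

/-- `x` has exactly two neighbours. -/
def DegTwo (G : SimpleGraph α) (x : α) : Prop := ∃ p q, p ≠ q ∧ ∀ y, G.Adj x y ↔ y = p ∨ y = q

/-- `K` is a connected set of vertices of degree two, attached exactly once to each of `u`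
and `v` and to nothing else. -/
structure IsThread (G : SimpleGraph α) (u v : α) (K : Set α) : Prop where
  conn : Conn G K
  ne : u ≠ v
  left_notMem : u ∉ K
  right_notMem : v ∉ K
  degTwo : ∀ x ∈ K, DegTwo G x
  attached : ∀ x ∈ K, ∀ y, G.Adj x y → y ∈ K ∨ y = u ∨ y = v
  left : ∃ t ∈ K, ∀ x ∈ K, G.Adj u x ↔ x = t
  right : ∃ t ∈ K, ∀ x ∈ K, G.Adj v x ↔ x = t

namespace IsThread

variable {u v : α} {K : Set α}

lemma symm (h : IsThread G u v K) : IsThread G v u K where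
  conn := h.conn
  ne := h.ne.symm
  left_notMem := h.right_notMem
  right_notMem := h.left_notMem
  degTwo := h.degTwo
  attached x hx y hxy := (h.attached x hx y hxy).imp_right Or.symm
  left := h.right
  right := h.left

lemma insert (h : IsThread G u v K) (huv : ¬ G.Adj u v) {t : α} (htK : t ∉ K) (htv : t ≠ v)
    (hut : G.Adj u t) (hu : ∀ y, G.Adj u y → y ∈ K ∨ y = t) : IsThread G t v (K ∪ {u}) := by
  obtain ⟨a, ha, hua⟩ := h.left
  obtain ⟨b, hb, hvb⟩ := h.right
  have htK' : ∀ x ∈ K, ¬ G.Adj t x := by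
    intro x hx hxt
    rcases h.attached x hx t hxt.symm with h' | h' | h'
    exacts [htK h', hut.ne h'.symm, htv h']
  refine ⟨h.conn.union (conn_singleton u) ⟨a, ha, u, rfl, ((hua a ha).2 rfl).symm⟩, htv, ?_, ?_,
    ?_, ?_, ?_, ?_⟩
  · rintro (h' | h')
    exacts [htK h', hut.ne h'.symm]
  · rintro (h' | h')
    exacts [h.right_notMem h', h.ne h'.symm]
  · rintro x (hx | hx)
    · exact h.degTwo x hx
    · rw [hx]
      refine ⟨a, t, by rintro rfl; exact htK ha, fun y => ⟨fun hy => ?_, ?_⟩⟩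
      · rcases hu y hy with h' | h'
        exacts [Or.inl ((hua y h').1 hy), Or.inr h']
      · rintro (rfl | rfl)
        exacts [(hua y ha).2 rfl, hut]
  · rintro x (hx | hx) y hxy
    · rcases h.attached x hx y hxy with h' | h' | h'
      exacts [Or.inl (Or.inl h'), Or.inl (Or.inr h'), Or.inr (Or.inr h')]
    · rw [hx] at hxy
      rcases hu y hxy with h' | h'
      exacts [Or.inl (Or.inl h'), Or.inr (Or.inl h')]
  · refine ⟨u, Or.inr rfl, ?_⟩
    rintro x (hx | hx)
    · exact ⟨fun h' => (htK' x hx h').elim, fun h' => (h.left_notMem (h' ▸ hx)).elim⟩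
    · rw [hx]; exact ⟨fun _ => rfl, fun _ => hut.symm⟩
  · refine ⟨b, Or.inl hb, ?_⟩
    rintro x (hx | hx)
    · exact hvb x hx
    · rw [hx]
      exact ⟨fun h' => (huv h'.symm).elim, fun h' => (h.left_notMem (h' ▸ hb)).elim⟩

lemma isBasicPath (h : IsThread G u v K) : IsBasicPath G K := by
  obtain ⟨t, ht, hut⟩ := h.left
  obtain ⟨w, hw, hvw⟩ := h.right
  obtain ⟨m, k, rfl, rfl, hkK, hk⟩ := h.conn.exists_isInducedPath ht hw
  have huk : G.Adj (k 0) u := ((hut _ ht).2 rfl).symm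
  have hvk : G.Adj (k m) v := ((hvw _ hw).2 rfl).symm
  have two : ∀ x ∈ K, ∀ a b y, a ≠ b → G.Adj x a → G.Adj x b → G.Adj x y → y = a ∨ y = b := by
    intro x hx a b y hab ha hb hy
    obtain ⟨p, q, -, hpq⟩ := h.degTwo x hx
    rw [hpq] at ha hb hy
    grind
  have hku : ∀ i, k i ≠ u := fun i hi => h.left_notMem (hi ▸ hkK i)
  have hkv : ∀ i, k i ≠ v := fun i hi => h.right_notMem (hi ▸ hkK i)
  refine hk.isBasicPath (fun i _ => hkK i) ?_ ?_
  · refine h.conn.subset_of_closed (B := {x | ∃ i ≤ m, k i = x}) ht ⟨0, Nat.zero_le m, rfl⟩ ?_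
    rintro - ⟨i, hi, rfl⟩ - y hy hxy
    have hyu : y ≠ u := by rintro rfl; exact h.left_notMem hy
    have hyv : y ≠ v := by rintro rfl; exact h.right_notMem hy
    rcases Nat.eq_zero_or_pos i with rfl | hi0
    · rcases Nat.eq_zero_or_pos m with rfl | hm0
      · exact ((two _ ht _ _ y h.ne huk hvk hxy).elim hyu hyv).elim
      · have := (two _ ht _ _ y (hku 1).symm huk ((hk.adj_iff hi hm0).2 (by omega)) hxy)
        exact ⟨1, hm0, (this.resolve_left hyu).symm⟩
    · have hpred : G.Adj (k i) (k (i - 1)) := (hk.adj_iff hi (by omega)).2 (by omega)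
      rcases hi.eq_or_lt with rfl | him
      · have := (two _ hw _ _ y (hkv (i - 1)).symm hvk hpred hxy)
        exact ⟨i - 1, by omega, (this.resolve_left hyv).symm⟩
      · rcases two _ (hkK i) _ _ y (hk (i - 1) (i + 1) (by omega) (by omega)).1 hpred
          ((hk.adj_iff hi (by omega)).2 (by omega)) hxy with h' | h'
        exacts [⟨i - 1, by omega, h'.symm⟩, ⟨i + 1, by omega, h'.symm⟩]
  · intro i hi him y hy
    rcases h.attached _ (hkK i) y hy with h' | rfl | rfl
    · exact h'
    · exact ((hk 0 i hi him.le).1 ((hut _ (hkK i)).1 hy.symm).symm).elim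
    · exact ((hk i m him le_rfl).1 ((hvw _ (hkK i)).1 hy.symm)).elim

end IsThread

lemma Touch.exists_unique_or_two {K : Set α} {u : α} (h : Touch G K {u}) :
    (∃ t ∈ K, ∀ x ∈ K, G.Adj u x ↔ x = t) ∨
      ∃ x ∈ K, ∃ y ∈ K, x ≠ y ∧ G.Adj u x ∧ G.Adj u y := by
  obtain ⟨t, ht, htu⟩ := touch_singleton_right.1 h
  by_cases hc : ∃ x ∈ K, x ≠ t ∧ G.Adj u x
  · obtain ⟨x, hx, hxt, hux⟩ := hc
    exact Or.inr ⟨x, hx, t, ht, hxt, hux, htu.symm⟩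
  · push Not at hc
    refine Or.inl ⟨t, ht, fun x hx => ⟨fun hux => ?_, ?_⟩⟩
    · by_contra hxt; exact hc x hx hxt hux
    · rintro rfl; exact htu.symm

/-- A vertex of degree two yields a good pair to delete. -/
lemma exists_pair_of_degTwo [Fintype α] (h2 : TwoConnected G) (hg : ¬ IsInducedMinor gem G)
    {r : α} (hr : DegTwo G r) :
    ∃ u v, ∀ L, IsComp G {x | x ≠ u ∧ x ≠ v} L → IsCographOrPath G L := by
  have hstart : ∃ u v, IsThread G u v {r} := by
    obtain ⟨p, q, hpq, hN⟩ := id hr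
    have hp : G.Adj r p := (hN p).2 (Or.inl rfl)
    have hq : G.Adj r q := (hN q).2 (Or.inr rfl)
    refine ⟨p, q, conn_singleton r, hpq, hp.ne.symm, hq.ne.symm, ?_, ?_,
      ⟨r, rfl, ?_⟩, ⟨r, rfl, ?_⟩⟩
    · rintro x rfl; exact hr
    · rintro x rfl y hy; exact Or.inr ((hN y).1 hy)
    · rintro x rfl; exact ⟨fun _ => rfl, fun _ => hp.symm⟩
    · rintro x rfl; exact ⟨fun _ => rfl, fun _ => hq.symm⟩
  obtain ⟨K, -, ⟨u, v, hK⟩, hmax⟩ :=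
    exists_maximal_ge_of_wellFoundedGT (fun K : Set α => ∃ u v, IsThread G u v K) {r} hstart
  have huv := hK.ne
  have hKc := isComp_compl_pair hK.conn hK.left_notMem hK.right_notMem hK.attached
  refine ⟨u, v, fun L hL => ?_⟩
  by_cases hLK : K = L
  · exact Or.inr (hLK ▸ hK.isBasicPath)
  by_cases hex : G.Adj u v ∨ ∃ Z, IsComp G {x | x ≠ u ∧ x ≠ v} Z ∧ Z ≠ L ∧ Z ≠ K
  · exact hL.isCographOrPath h2 hg huv hKc hLK hex
  push Not at hex
  obtain ⟨nuv, hcomps⟩ := hex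
  have hcover : ∀ x, x ≠ u → x ≠ v → x ∈ K ∨ x ∈ L := by
    intro x hxu hxv
    obtain ⟨Z, hZ, hxZ⟩ := exists_isComp G (M := {x | x ≠ u ∧ x ≠ v}) (x := x) ⟨hxu, hxv⟩
    by_cases hZL : Z = L
    · exact Or.inr (hZL ▸ hxZ)
    · exact Or.inl (hcomps Z hZ hZL ▸ hxZ)
  have hdis := hKc.notMem_of_ne hL hLK
  have hdis' := hL.notMem_of_ne hKc (Ne.symm hLK)
  have hnoext : ∀ a b, IsThread G a b K → ¬ G.Adj a b → a ∉ L → b ∉ L →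
      (∀ x, x ≠ a → x ≠ b → x ∈ K ∨ x ∈ L) → ¬ ∃ t ∈ L, ∀ x ∈ L, G.Adj a x ↔ x = t := by
    rintro a b hab nab haL hbL hcov ⟨t, ht, hat⟩
    have := hab.insert nab (hdis' t ht) (by rintro rfl; exact hbL ht) ((hat t ht).2 rfl)
      (by
        intro y hy
        rcases hcov y hy.ne.symm (by rintro rfl; exact nab hy) with h | h
        exacts [Or.inl h, Or.inr ((hat y h).1 hy)])
    exact hab.left_notMem (hmax ⟨t, b, this⟩ Set.subset_union_left (Or.inr rfl))
  have hu := (hL.touch_left h2 huv).exists_unique_or_two.resolve_left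
    (hnoext u v hK nuv hL.left_notMem hL.right_notMem hcover)
  have hv := (hL.touch_right h2 huv).exists_unique_or_two.resolve_left
    (hnoext v u hK.symm (fun h => nuv h.symm) hL.right_notMem hL.left_notMem
      (fun x h h' => hcover x h' h))
  exact Or.inl (isCograph_of_complete hg (complete_of_two_attachments h2 hg huv nuv hK.conn hL.conn
    hK.left_notMem hL.left_notMem hK.right_notMem hL.right_notMem hdis hL.attached
    (hKc.touch_left h2 huv) (hKc.touch_right h2 huv) hu hv).1)

/-- `u, v` separate the connected set `K` from some other vertex. -/
structure IsSeparation (G : SimpleGraph α) (u v : α) (K : Set α) : Prop where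
  conn : Conn G K
  ne : u ≠ v
  left_notMem : u ∉ K
  right_notMem : v ∉ K
  attached : ∀ x ∈ K, ∀ y, G.Adj x y → y ∈ K ∨ y = u ∨ y = v
  exists_notMem : ∃ z, z ∉ K ∧ z ≠ u ∧ z ≠ v

lemma IsSeparation.symm {u v : α} {K : Set α} (h : IsSeparation G u v K) :
    IsSeparation G v u K :=
  ⟨h.conn, h.ne.symm, h.right_notMem, h.left_notMem,
    fun x hx y hxy => (h.attached x hx y hxy).imp_right Or.symm,
    h.exists_notMem.imp fun _ hz => ⟨hz.1, hz.2.symm⟩⟩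

/-- A separation of order two yields a good pair to delete, if there is no vertex of degree two. -/
lemma exists_pair_of_isSeparation [Fintype α] (h2 : TwoConnected G)
    (hg : ¬ IsInducedMinor gem G) (hdeg : ∀ r, ¬ DegTwo G r) {a b : α} {S : Set α}
    (hS : IsSeparation G a b S) :
    ∃ u v, ∀ L, IsComp G {x | x ≠ u ∧ x ≠ v} L → IsCographOrPath G L := by
  obtain ⟨K, -, ⟨u, v, hK⟩, hmin⟩ := exists_minimal_le_of_wellFoundedLT
    (fun K : Set α => ∃ u v, IsSeparation G u v K) S ⟨a, b, hS⟩
  have huv := hK.ne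
  have hKc := isComp_compl_pair hK.conn hK.left_notMem hK.right_notMem hK.attached
  obtain ⟨z, hzK, hzuv⟩ := hK.exists_notMem
  obtain ⟨J, hJ, hzJ⟩ := exists_isComp G (M := {x | x ≠ u ∧ x ≠ v}) hzuv
  have hKJ : K ≠ J := by rintro rfl; exact hzK hzJ
  have htwo : ∀ a b, IsSeparation G a b K → ¬ ∃ t ∈ K, ∀ x ∈ K, G.Adj a x ↔ x = t := by
    rintro a b hab ⟨t, ht, hat⟩
    have hKab := isComp_compl_pair hab.conn hab.left_notMem hab.right_notMem hab.attached
    by_cases hKt : ∃ y ∈ K, y ≠ t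
    · obtain ⟨y, hy, hyt⟩ := hKt
      obtain ⟨D, hD, hyD⟩ := exists_isComp G (M := K \ {t}) (x := y) ⟨hy, hyt⟩
      have hDK : ∀ x ∈ D, x ∈ K ∧ x ≠ t := fun x hx => hD.subset hx
      refine (hDK t (hmin ⟨t, b, hD.conn, by rintro rfl; exact hab.right_notMem ht,
        fun h => (hDK t h).2 rfl, fun h => hab.right_notMem (hDK b h).1, ?_,
        a, fun h => hab.left_notMem (hDK a h).1, by rintro rfl; exact hab.left_notMem ht,
        hab.ne⟩ (fun x hx => (hDK x hx).1) ht)).2 rfl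
      intro x hx y hxy
      by_cases hyt : y = t
      · exact Or.inr (Or.inl hyt)
      rcases hab.attached x (hDK x hx).1 y hxy with h | rfl | h
      · exact Or.inl (hD.mem_of_adj hx ⟨h, hyt⟩ hxy)
      · exact ((hDK x hx).2 ((hat x (hDK x hx).1).1 hxy.symm)).elim
      · exact Or.inr (Or.inr h)
    · push Not at hKt
      obtain ⟨x, hx, hxb⟩ := touch_singleton_right.1 (hKab.touch_right h2 hab.ne)
      obtain rfl := hKt x hx
      refine hdeg x ⟨a, b, hab.ne, fun y => ⟨fun hy => ?_, ?_⟩⟩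
      · rcases hab.attached x hx y hy with h | h
        · exact (hy.ne (hKt y h).symm).elim
        · exact h
      · rintro (rfl | rfl)
        exacts [((hat x hx).2 rfl).symm, hxb]
  refine ⟨u, v, fun L hL => ?_⟩
  by_cases hex : G.Adj u v ∨ ∃ Z, IsComp G {x | x ≠ u ∧ x ≠ v} Z ∧ Z ≠ K ∧ Z ≠ J
  · by_cases hLK : K = L
    · subst hLK
      exact hL.isCographOrPath h2 hg huv hJ (Ne.symm hKJ) hex
    · refine hL.isCographOrPath h2 hg huv hKc hLK (hex.imp_right ?_)
      rintro ⟨Z, hZ, hZK, hZJ⟩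
      by_cases hLJ : J = L
      · exact ⟨Z, hZ, hLJ ▸ hZJ, hZK⟩
      · exact ⟨J, hJ, hLJ, Ne.symm hKJ⟩
  push Not at hex
  obtain ⟨nuv, hcomps⟩ := hex
  have hu := (hKc.touch_left h2 huv).exists_unique_or_two.resolve_left (htwo u v hK)
  have hv := (hKc.touch_right h2 huv).exists_unique_or_two.resolve_left (htwo v u hK.symm)
  obtain ⟨hcompl, c, hcK, huc, hvc, W, hWK, hcW, cW, tWu, tWv, -⟩ :=
    complete_of_two_attachments h2 hg huv nuv hJ.conn hK.conn hJ.left_notMem hK.left_notMem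
      hJ.right_notMem hK.right_notMem (hJ.notMem_of_ne hKc (Ne.symm hKJ)) hK.attached
      (hJ.touch_left h2 huv) (hJ.touch_right h2 huv) hu hv
  by_cases hLK : L = K
  · exact Or.inl (hLK ▸ isCograph_of_complete hg hcompl)
  obtain rfl := hcomps L hL hLK
  have hdis := hKc.notMem_of_ne hL hKJ
  refine isCographOrPath_of_linked h2 hg huv (R := W) (Z := {c}) hL
    ((conn_singleton u).union (conn_singleton c) ⟨u, rfl, c, rfl, huc⟩)
    ((conn_singleton v).union (conn_singleton c) ⟨v, rfl, c, rfl, hvc⟩)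
    ⟨u, rfl, c, Or.inr rfl, huc⟩ ⟨v, rfl, c, Or.inr rfl, hvc⟩ cW tWu tWv
    (fun h => hK.left_notMem (hWK h)) huc.ne (fun h => hK.right_notMem (hWK h)) hvc.ne ?_
    (fun x hx => hdis x (hWK hx)) ?_
  · rintro x hx rfl; exact hcW hx
  · rintro x rfl; exact hdis x hcK

end Separations

section InducedPathFour

variable {α : Type*} {G : SimpleGraph α}

/-- `a, b, c, d` is an induced path on four vertices. -/
structure IsPathFour (G : SimpleGraph α) (a b c d : α) : Prop where
  ab : G.Adj a b
  bc : G.Adj b c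
  cd : G.Adj c d
  nac : ¬ G.Adj a c
  nad : ¬ G.Adj a d
  nbd : ¬ G.Adj b d

namespace IsPathFour

variable {a b c d : α}

lemma reverse (h : IsPathFour G a b c d) : IsPathFour G d c b a :=
  ⟨h.cd.symm, h.bc.symm, h.ab.symm, fun e => h.nbd e.symm, fun e => h.nad e.symm,
    fun e => h.nac e.symm⟩

lemma pairwise_ne (h : IsPathFour G a b c d) :
    a ≠ b ∧ a ≠ c ∧ a ≠ d ∧ b ≠ c ∧ b ≠ d ∧ c ≠ d := by
  refine ⟨h.ab.ne, ?_, ?_, h.bc.ne, ?_, h.cd.ne⟩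
  · rintro rfl; exact h.nad h.cd
  · rintro rfl; exact h.nac h.cd.symm
  · rintro rfl; exact h.nad h.ab

end IsPathFour

lemma compl_four_reverse (a b c d : α) : ({d, c, b, a} : Set α)ᶜ = {a, b, c, d}ᶜ := by
  ext x; simp only [Set.mem_compl_iff, Set.mem_insert_iff, Set.mem_singleton_iff]; tauto

lemma not_touch_singleton {x y : α} (h : ¬ G.Adj x y) : ¬ Touch G {x} {y} := by
  simpa [Touch] using h

lemma touch_singleton {x y : α} (h : G.Adj x y) : Touch G {x} {y} := ⟨x, rfl, y, rfl, h⟩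

section Components

variable {a b c d : α} {D E : Set α}

lemma IsComp.attached_four (hD : IsComp G {a, b, c, d}ᶜ D) {x y : α} (hx : x ∈ D)
    (hxy : G.Adj x y) : y ∈ D ∨ y = a ∨ y = b ∨ y = c ∨ y = d := by
  by_contra! h
  exact h.1 (hD.mem_of_adj hx (by simp [h.2]) hxy)

lemma IsComp.notMem_four (hD : IsComp G {a, b, c, d}ᶜ D) : a ∉ D ∧ b ∉ D ∧ c ∉ D ∧ d ∉ D := by
  refine ⟨fun h => ?_, fun h => ?_, fun h => ?_, fun h => ?_⟩ <;> exact hD.subset h (by simp)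

/-- Without separations of order two, a component outside an induced path on four vertices
misses exactly one vertex of the path. -/
lemma IsPathFour.exists_missed (h : IsPathFour G a b c d) (hg : ¬ IsInducedMinor gem G)
    (hsep : ∀ u v K, ¬ IsSeparation G u v K) (hD : IsComp G {a, b, c, d}ᶜ D) :
    (¬ Touch G D {a} ∧ Touch G D {b} ∧ Touch G D {c} ∧ Touch G D {d}) ∨
    (Touch G D {a} ∧ ¬ Touch G D {b} ∧ Touch G D {c} ∧ Touch G D {d}) ∨
    (Touch G D {a} ∧ Touch G D {b} ∧ ¬ Touch G D {c} ∧ Touch G D {d}) ∨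
    (Touch G D {a} ∧ Touch G D {b} ∧ Touch G D {c} ∧ ¬ Touch G D {d}) := by
  obtain ⟨hab, hac, had, hbc, hbd, hcd⟩ := h.pairwise_ne
  obtain ⟨ha, hb, hc, hd⟩ := hD.notMem_four
  have hmiss : ∀ p q r s, ({p, q, r, s} : Set α)ᶜ = {a, b, c, d}ᶜ → p ≠ q → r ≠ p → r ≠ q →
      Touch G D {r} ∨ Touch G D {s} := by
    intro p q r s hset hpq hrp hrq
    by_contra! hcon
    have hD' := hset ▸ hD
    obtain ⟨hp, hq, hr, hs⟩ := hD'.notMem_four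
    refine hsep p q D ⟨hD.conn, hpq, hp, hq, fun x hx y hxy => ?_, r, hr, hrp, hrq⟩
    rcases hD'.attached_four hx hxy with h' | h' | h' | rfl | rfl
    · exact Or.inl h'
    · exact Or.inr (Or.inl h')
    · exact Or.inr (Or.inr h')
    · exact (hcon.1 ⟨x, hx, y, rfl, hxy⟩).elim
    · exact (hcon.2 ⟨x, hx, y, rfl, hxy⟩).elim
  have hall : ¬ (Touch G D {a} ∧ Touch G D {b} ∧ Touch G D {c} ∧ Touch G D {d}) := by
    rintro ⟨ta, tb, tc, td⟩
    exact hg (gem_of hD.conn (conn_singleton a) (conn_singleton b) (conn_singleton c)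
      (conn_singleton d) (by grind) ta tb tc td (touch_singleton h.ab) (touch_singleton h.bc)
      (touch_singleton h.cd) (not_touch_singleton h.nac) (not_touch_singleton h.nad)
      (not_touch_singleton h.nbd))
  have hset : ∀ p q r s : α, (∀ x, (x = p ∨ x = q ∨ x = r ∨ x = s) ↔
      (x = a ∨ x = b ∨ x = c ∨ x = d)) → ({p, q, r, s} : Set α)ᶜ = {a, b, c, d}ᶜ := by
    intro p q r s hx
    ext x
    simp only [Set.mem_compl_iff, Set.mem_insert_iff, Set.mem_singleton_iff, hx]
  have h₁ := hmiss a b c d rfl hab hac.symm hbc.symm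
  have h₂ := hmiss a c b d (hset _ _ _ _ (by clear * -; tauto)) hac hab.symm hbc
  have h₃ := hmiss a d b c (hset _ _ _ _ (by clear * -; tauto)) had hab.symm hbd
  have h₄ := hmiss b c a d (hset _ _ _ _ (by clear * -; tauto)) hbc hab hac
  have h₅ := hmiss b d a c (hset _ _ _ _ (by clear * -; tauto)) hbd hab had
  have h₆ := hmiss c d a b (hset _ _ _ _ (by clear * -; tauto)) hcd hac had
  clear hmiss hset
  generalize Touch G D {a} = A at *
  generalize Touch G D {b} = B at *
  generalize Touch G D {c} = C at *
  generalize Touch G D {d} = F at *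
  clear * - hall h₁ h₂ h₃ h₄ h₅ h₆
  by_cases A <;> by_cases B <;> by_cases C <;> simp_all

lemma IsPathFour.touch_left [Fintype α] (h : IsPathFour G a b c d) (h2 : TwoConnected G)
    (hg : ¬ IsInducedMinor gem G) (hsep : ∀ u v K, ¬ IsSeparation G u v K)
    (hD : IsComp G {a, b, c, d}ᶜ D) : Touch G D {a} := by
  by_contra hDa
  obtain ⟨hab, hac, had, hbc, hbd, hcd⟩ := h.pairwise_ne
  obtain ⟨tb, tc, td⟩ : Touch G D {b} ∧ Touch G D {c} ∧ Touch G D {d} := by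
    have := h.exists_missed hg hsep hD
    tauto
  have hall : ∀ E, IsComp G {a, b, c, d}ᶜ E → ¬ Touch G E {a} := by
    intro E hE hEa
    have hne : E ≠ D := by rintro rfl; exact hDa hEa
    have hdis := hE.notMem_of_ne hD hne
    have nED : ¬ Touch G E D := fun h => hne (hE.eq_of_touch hD h)
    have nDE : ¬ Touch G D E := fun h => nED h.symm
    have naD : ¬ Touch G {a} D := fun h => hDa h.symm
    obtain ⟨haD, hbD, hcD, hdD⟩ := hD.notMem_four
    obtain ⟨haE, hbE, hcE, hdE⟩ := hE.notMem_four
    rcases h.exists_missed hg hsep hE with h' | ⟨ea, eb, ec, ed⟩ | ⟨ea, eb, ec, ed⟩ |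
      ⟨ea, eb, ec, ed⟩
    · exact h'.1 hEa
    · exact hg (gem_of (conn_singleton c) (conn_singleton b) hD.conn (conn_singleton d) hE.conn
        (by grind) (touch_singleton h.bc.symm) tc.symm (touch_singleton h.cd) ec.symm tb.symm td
        ed.symm (not_touch_singleton h.nbd) (fun h => eb h.symm) nDE)
    · exact hg (gem_of ((conn_singleton b).union (conn_singleton c) (touch_singleton h.bc))
        (conn_singleton a) hE.conn (conn_singleton d) hD.conn (by grind)
        ((touch_singleton h.ab.symm).mono Set.subset_union_left le_rfl)
        (eb.symm.mono Set.subset_union_left le_rfl)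
        ((touch_singleton h.cd).mono Set.subset_union_right le_rfl)
        (tb.symm.mono Set.subset_union_left le_rfl) ea.symm ed td.symm
        (not_touch_singleton h.nad) naD nED)
    · exact hg (gem_of (conn_singleton b) (conn_singleton a) hE.conn (conn_singleton c) hD.conn
        (by grind) (touch_singleton h.ab.symm) eb.symm (touch_singleton h.bc) tb.symm ea.symm ec
        tc.symm (not_touch_singleton h.nac) naD nED)
  obtain ⟨x, hx, y, hya, hyb, hxy⟩ := h2.exists_adj (D := {a}) (x := a) rfl hab.symm (z := c)
    hac.symm hbc.symm
  rw [Set.mem_singleton_iff] at hx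
  subst hx
  obtain ⟨E, hE, hyE⟩ := exists_isComp G (M := {x, b, c, d}ᶜ) (x := y) (by
    rintro (h' | h' | h' | h')
    · exact hya h'
    · exact hyb h'
    · exact h.nac (h' ▸ hxy)
    · exact h.nad (h' ▸ hxy))
  exact hall E hE ⟨y, hyE, x, rfl, hxy.symm⟩

lemma IsPathFour.exists_comp_touching_third (h : IsPathFour G a b c d)
    (hsep : ∀ u v K, ¬ IsSeparation G u v K) :
    ∃ D, IsComp G {a, b, c, d}ᶜ D ∧ Touch G D {c} := by
  obtain ⟨hab, hac, had, hbc, hbd, hcd⟩ := h.pairwise_ne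
  by_contra! hcon
  refine hsep b d {c} ⟨conn_singleton c, hbd, hbc, hcd.symm, ?_, a, hac, hab, had⟩
  rintro x rfl y hxy
  by_contra! hy
  obtain ⟨D, hD, hyD⟩ := exists_isComp G (M := {a, b, x, d}ᶜ) (x := y) (by
    rintro (h' | h' | h' | h')
    · exact h.nac (h' ▸ hxy).symm
    · exact hy.2.1 h'
    · exact hy.1 h'
    · exact hy.2.2 h')
  exact hcon D hD ⟨y, hyD, x, rfl, hxy.symm⟩

lemma IsPathFour.comp_unique (h : IsPathFour G a b c d) (hg : ¬ IsInducedMinor gem G)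
    {D' : Set α} (hD : IsComp G {a, b, c, d}ᶜ D) (hD' : IsComp G {a, b, c, d}ᶜ D')
    (hE : IsComp G {a, b, c, d}ᶜ E) (tDa : Touch G D {a}) (tDc : Touch G D {c})
    (nDb : ¬ Touch G D {b}) (tDa' : Touch G D' {a}) (tDc' : Touch G D' {c})
    (nDb' : ¬ Touch G D' {b}) (tEa : Touch G E {a}) (tEb : Touch G E {b})
    (nEc : ¬ Touch G E {c}) : D = D' := by
  by_contra hne
  obtain ⟨hab, hac, had, hbc, hbd, hcd⟩ := h.pairwise_ne
  have hDE : E ≠ D := by rintro rfl; exact nDb tEb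
  have hDE' : E ≠ D' := by rintro rfl; exact nDb' tEb
  have d₁ := hD.notMem_of_ne hD' hne
  have d₂ := hE.notMem_of_ne hD hDE
  have d₃ := hE.notMem_of_ne hD' hDE'
  have e₁ := hD.notMem_four
  have e₂ := hD'.notMem_four
  have e₃ := hE.notMem_four
  exact hg (gem_of ((conn_singleton a).union hD.conn tDa.symm) hE.conn (conn_singleton b)
    (conn_singleton c) hD'.conn (by grind) (tEa.symm.mono Set.subset_union_left le_rfl)
    ((touch_singleton h.ab).mono Set.subset_union_left le_rfl)
    (tDc.mono Set.subset_union_right le_rfl) (tDa'.symm.mono Set.subset_union_left le_rfl) tEb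
    (touch_singleton h.bc) tDc'.symm nEc (fun h => hDE' (hE.eq_of_touch hD' h))
    (fun h => nDb' h.symm))

/-- Attachments of a connected part of a component `D` that misses `b`, given another
component `E` touching `a`, `b` and `d`. -/
lemma IsPathFour.part_cases (h : IsPathFour G a b c d)
    (hg : ¬ IsInducedMinor gem G) (hD : IsComp G {a, b, c, d}ᶜ D)
    (hE : IsComp G {a, b, c, d}ᶜ E) (tEa : Touch G E {a}) (tEb : Touch G E {b})
    (tEd : Touch G E {d}) (nDb : ¬ Touch G D {b}) {P : Set α} (hPD : P ⊆ D) (cP : Conn G P) :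
    ¬ (Touch G P {a} ∧ Touch G P {c} ∧ ¬ Touch G P {d}) ∧
    ¬ (Touch G P {c} ∧ Touch G P {d} ∧ ¬ Touch G P {a}) := by
  obtain ⟨hab, hac, had, hbc, hbd, hcd⟩ := h.pairwise_ne
  have hDE : D ≠ E := by rintro rfl; exact nDb tEb
  have dDE := hD.notMem_of_ne hE hDE
  have nDE : ¬ Touch G D E := fun h => hDE (hD.eq_of_touch hE h)
  obtain ⟨haD, hbD, hcD, hdD⟩ := hD.notMem_four
  obtain ⟨haE, hbE, hcE, hdE⟩ := hE.notMem_four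
  have cbc : Conn G ({b} ∪ {c}) :=
    (conn_singleton b).union (conn_singleton c) (touch_singleton h.bc)
  replace dDE : ∀ x ∈ P, x ∉ E := fun x hx => dDE x (hPD hx)
  replace haD : a ∉ P := fun h' => haD (hPD h')
  replace hbD : b ∉ P := fun h' => hbD (hPD h')
  replace hcD : c ∉ P := fun h' => hcD (hPD h')
  replace hdD : d ∉ P := fun h' => hdD (hPD h')
  have nPE : ¬ Touch G P E := fun h' => nDE (h'.mono hPD le_rfl)
  refine ⟨?_, ?_⟩
  · rintro ⟨ha, hc, hd⟩
    exact hg (gem_of cbc cP (conn_singleton a) hE.conn (conn_singleton d) (by grind)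
      (hc.symm.mono Set.subset_union_right le_rfl)
      ((touch_singleton h.ab.symm).mono Set.subset_union_left le_rfl)
      (tEb.symm.mono Set.subset_union_left le_rfl)
      ((touch_singleton h.cd).mono Set.subset_union_right le_rfl) ha tEa.symm tEd nPE hd
      (not_touch_singleton h.nad))
  · rintro ⟨hc, hd, ha⟩
    exact hg (gem_of cbc cP (conn_singleton d) hE.conn (conn_singleton a) (by grind)
      (hc.symm.mono Set.subset_union_right le_rfl)
      ((touch_singleton h.cd).mono Set.subset_union_right le_rfl)
      (tEb.symm.mono Set.subset_union_left le_rfl)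
      ((touch_singleton h.ab.symm).mono Set.subset_union_left le_rfl) hd tEd.symm tEa nPE ha
      (not_touch_singleton h.reverse.nad))

/-- Joint attachments of two touching disjoint connected parts of a component `D` that misses
`b`, given another component `E` that misses `c`. -/
lemma IsPathFour.pair_cases (h : IsPathFour G a b c d)
    (hg : ¬ IsInducedMinor gem G) (hD : IsComp G {a, b, c, d}ᶜ D)
    (hE : IsComp G {a, b, c, d}ᶜ E) (tEa : Touch G E {a}) (tEb : Touch G E {b})
    (tEd : Touch G E {d}) (nEc : ¬ Touch G E {c})
    (nDb : ¬ Touch G D {b}) {P Q : Set α} (hPD : P ⊆ D) (hQD : Q ⊆ D) (cP : Conn G P)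
    (cQ : Conn G Q) (dPQ : ∀ x ∈ P, x ∉ Q) (tPQ : Touch G P Q) :
    ¬ (Touch G P {a} ∧ Touch G P {d} ∧ Touch G Q {c} ∧ ¬ Touch G Q {d}) ∧
    ¬ (Touch G P {a} ∧ Touch G P {c} ∧ Touch G Q {a}) ∧
    ¬ (Touch G P {c} ∧ Touch G P {d} ∧ Touch G Q {c} ∧ ¬ Touch G Q {d}) ∧
    ¬ (Touch G P {c} ∧ Touch G P {d} ∧ Touch G Q {d} ∧ ¬ Touch G Q {c}) := by
  obtain ⟨hab, hac, had, hbc, hbd, hcd⟩ := h.pairwise_ne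
  have hDE : D ≠ E := by rintro rfl; exact nDb tEb
  have dDE := hD.notMem_of_ne hE hDE
  have nDE : ¬ Touch G D E := fun h => hDE (hD.eq_of_touch hE h)
  obtain ⟨haD, hbD, hcD, hdD⟩ := hD.notMem_four
  obtain ⟨haE, hbE, hcE, hdE⟩ := hE.notMem_four
  have cbc : Conn G ({b} ∪ {c}) :=
    (conn_singleton b).union (conn_singleton c) (touch_singleton h.bc)
  have cbE : Conn G ({b} ∪ E) := (conn_singleton b).union hE.conn tEb.symm
  have nEP : ¬ Touch G E P := fun h' => nDE (h'.symm.mono hPD le_rfl)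
  have nEQ : ¬ Touch G E Q := fun h' => nDE (h'.symm.mono hQD le_rfl)
  have nbP : ¬ Touch G {b} P := fun h' => nDb (h'.symm.mono hPD le_rfl)
  have nbQ : ¬ Touch G {b} Q := fun h' => nDb (h'.symm.mono hQD le_rfl)
  have nbEP : ¬ Touch G ({b} ∪ E) P := by
    rintro ⟨x, hx | hx, y, hy, hxy⟩
    exacts [nbP ⟨x, hx, y, hy, hxy⟩, nEP ⟨x, hx, y, hy, hxy⟩]
  have nbEQ : ¬ Touch G ({b} ∪ E) Q := by
    rintro ⟨x, hx | hx, y, hy, hxy⟩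
    exacts [nbQ ⟨x, hx, y, hy, hxy⟩, nEQ ⟨x, hx, y, hy, hxy⟩]
  refine ⟨?_, ?_, ?_, ?_⟩
  · rintro ⟨ha, hd, hc, hd'⟩
    exact hg (gem_of ((conn_singleton a).union cbc
        ((touch_singleton h.ab).mono le_rfl Set.subset_union_left)) hE.conn (conn_singleton d)
      cP cQ (by grind) (tEa.symm.mono Set.subset_union_left le_rfl)
      ((touch_singleton h.cd).mono (by simp) le_rfl) (ha.symm.mono Set.subset_union_left le_rfl)
      (hc.symm.mono (by simp) le_rfl) tEd hd.symm tPQ nEP nEQ (fun h' => hd' h'.symm))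
  · rintro ⟨ha, hc, ha'⟩
    refine hg (gem_of (conn_singleton a) hE.conn (conn_singleton b)
      ((conn_singleton c).union cP hc.symm) cQ (by grind) tEa.symm (touch_singleton h.ab)
      (ha.symm.mono le_rfl Set.subset_union_right) ha'.symm tEb
      ((touch_singleton h.bc).mono le_rfl Set.subset_union_left)
      (tPQ.mono Set.subset_union_right le_rfl) ?_ nEQ nbQ)
    rintro ⟨x, hx, y, hy | hy, hxy⟩
    exacts [nEc ⟨x, hx, y, hy, hxy⟩, nEP ⟨x, hx, y, hy, hxy⟩]
  · rintro ⟨hc, hd, hc', hd'⟩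
    exact hg (gem_of (conn_singleton c) cbE (conn_singleton d) cP cQ (by grind)
      ((touch_singleton h.bc.symm).mono le_rfl Set.subset_union_left) (touch_singleton h.cd)
      hc.symm hc'.symm (tEd.mono Set.subset_union_right le_rfl) hd.symm tPQ nbEP nbEQ
      (fun h' => hd' h'.symm))
  · rintro ⟨hc, hd, hd', hc'⟩
    exact hg (gem_of (conn_singleton d) cbE (conn_singleton c) cP cQ (by grind)
      (tEd.symm.mono le_rfl Set.subset_union_right) (touch_singleton h.cd.symm)
      hd.symm hd'.symm ((touch_singleton h.bc).mono Set.subset_union_left le_rfl) hc.symm tPQ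
      nbEP nbEQ (fun h' => hc' h'.symm))

lemma IsPathFour.subsingleton [Fintype α] (h : IsPathFour G a b c d) (h2 : TwoConnected G)
    (hg : ¬ IsInducedMinor gem G) (hD : IsComp G {a, b, c, d}ᶜ D)
    (hE : IsComp G {a, b, c, d}ᶜ E) (tDa : Touch G D {a}) (nDb : ¬ Touch G D {b})
    (tDc : Touch G D {c}) (tDd : Touch G D {d}) (tEa : Touch G E {a}) (tEb : Touch G E {b})
    (nEc : ¬ Touch G E {c}) (tEd : Touch G E {d}) : D.Subsingleton := by
  intro s hs s' hs'
  by_contra hss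
  obtain ⟨hab, hac, had, hbc, hbd, hcd⟩ := h.pairwise_ne
  have hDE : D ≠ E := by rintro rfl; exact nDb tEb
  have dDE := hD.notMem_of_ne hE hDE
  have nDE : ¬ Touch G D E := fun h => hDE (hD.eq_of_touch hE h)
  obtain ⟨haD, hbD, hcD, hdD⟩ := hD.notMem_four
  obtain ⟨haE, hbE, hcE, hdE⟩ := hE.notMem_four
  obtain ⟨r, hr, hra⟩ := touch_singleton_right.1 tDa
  obtain ⟨r', hr', y, hyD, hyr, hry⟩ : ∃ x ∈ D \ {r}, ∃ y, y ∉ D \ {r} ∧ y ≠ r ∧ G.Adj x y := by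
    obtain ⟨x, hx⟩ : ∃ x, x ∈ D \ {r} := by
      by_cases h' : s = r
      · exact ⟨s', hs', fun e => hss (h'.trans (Eq.symm e))⟩
      · exact ⟨s, hs, h'⟩
    exact h2.exists_adj (D := D \ {r}) (z := a) hx (by simp) (by simp [haD])
      (by rintro rfl; exact haD hr)
  have hyD' : y ∉ D := fun h' => hyD ⟨h', hyr⟩
  obtain ⟨Q, hQ, hrQ⟩ := exists_isComp G hr'
  have hQD : ∀ x ∈ Q, x ∈ D ∧ x ≠ r := fun x hx => hQ.subset hx
  have cP := hQ.conn_diff hD.conn (conn_singleton r) (by simpa using hr)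
  have hrP : r ∈ D \ Q := ⟨hr, fun h' => (hQD r h').2 rfl⟩
  have tQP : Touch G Q (D \ Q) :=
    (hQ.touch_of_conn hD.conn (Set.singleton_nonempty r) (by simpa using hr)).mono le_rfl
      (by simpa using hrP)
  have hcase : ∀ x, Touch G D {x} → Touch G (D \ Q) {x} ∨ Touch G Q {x} := by
    rintro x ⟨z, hz, w, hw, hzw⟩
    by_cases hzQ : z ∈ Q
    exacts [Or.inr ⟨z, hzQ, w, hw, hzw⟩, Or.inl ⟨z, ⟨hz, hzQ⟩, w, hw, hzw⟩]
  have tQ : Touch G Q {a} ∨ Touch G Q {c} ∨ Touch G Q {d} := by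
    rcases hD.attached_four hr'.1 hry with h' | h' | h' | h' | h'
    · exact (hyD' h').elim
    · exact Or.inl ⟨r', hrQ, y, h', hry⟩
    · exact (nDb ⟨r', hr'.1, y, h', hry⟩).elim
    · exact Or.inr (Or.inl ⟨r', hrQ, y, h', hry⟩)
    · exact Or.inr (Or.inr ⟨r', hrQ, y, h', hry⟩)
  have tPa : Touch G (D \ Q) {a} := ⟨r, hrP, a, rfl, hra⟩
  have hPD : D \ Q ⊆ D := Set.sdiff_subset
  have hQD' : Q ⊆ D := fun x hx => (hQD x hx).1
  have p₁ := h.part_cases hg hD hE tEa tEb tEd nDb hPD cP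
  have p₂ := h.part_cases hg hD hE tEa tEb tEd nDb hQD' hQ.conn
  have p₃ := h.pair_cases hg hD hE tEa tEb tEd nEc nDb hPD hQD' cP hQ.conn (fun x hx => hx.2)
    tQP.symm
  have p₄ := h.pair_cases hg hD hE tEa tEb tEd nEc nDb hQD' hPD hQ.conn cP
    (fun x hx hx' => hx'.2 hx) tQP
  have c₁ := hcase c tDc
  have c₂ := hcase d tDd
  clear * - p₁ p₂ p₃ p₄ c₁ c₂ tQ tPa
  generalize Touch G (D \ Q) {a} = A at *
  generalize Touch G (D \ Q) {c} = C at *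
  generalize Touch G (D \ Q) {d} = F at *
  generalize Touch G Q {a} = A' at *
  generalize Touch G Q {c} = C' at *
  generalize Touch G Q {d} = F' at *
  by_cases C <;> by_cases F <;> by_cases A' <;> by_cases C' <;> by_cases F' <;> simp_all

/-- A 2-connected graph without gem induced minor and without separations of order two is a
cograph or has at most six vertices. -/
lemma IsPathFour.card_le_six [Fintype α] (h : IsPathFour G a b c d) (h2 : TwoConnected G)
    (hg : ¬ IsInducedMinor gem G) (hsep : ∀ u v K, ¬ IsSeparation G u v K) :
    Fintype.card α ≤ 6 := by
  classical
  have hrev := compl_four_reverse a b c d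
  have hleft : ∀ D, IsComp G {a, b, c, d}ᶜ D → Touch G D {a} :=
    fun D hD => h.touch_left h2 hg hsep hD
  have hright : ∀ D, IsComp G {a, b, c, d}ᶜ D → Touch G D {d} :=
    fun D hD => h.reverse.touch_left h2 hg hsep (hrev ▸ hD)
  have htype : ∀ D, IsComp G {a, b, c, d}ᶜ D →
      (¬ Touch G D {b} ∧ Touch G D {c}) ∨ (Touch G D {b} ∧ ¬ Touch G D {c}) := by
    intro D hD
    have h₁ := hleft D hD
    have h₂ := hright D hD
    have h₃ := h.exists_missed hg hsep hD
    tauto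
  obtain ⟨D, hD, tDc⟩ := h.exists_comp_touching_third hsep
  obtain ⟨E, hE, tEb⟩ := h.reverse.exists_comp_touching_third hsep
  rw [hrev] at hE
  have nDb : ¬ Touch G D {b} := by have := htype D hD; tauto
  have nEc : ¬ Touch G E {c} := by have := htype E hE; tauto
  have hcover : ∀ F, IsComp G {a, b, c, d}ᶜ F → F = D ∨ F = E := by
    intro F hF
    rcases htype F hF with ⟨hb, hc⟩ | ⟨hb, hc⟩
    · exact Or.inl (h.comp_unique hg hF hD hE (hleft F hF) hc hb (hleft D hD) tDc nDb (hleft E hE)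
        tEb nEc)
    · exact Or.inr (h.reverse.comp_unique hg (hrev ▸ hF) (hrev ▸ hE) (hrev ▸ hD) (hright F hF) hb hc
        (hright E hE) tEb nEc (hright D hD) tDc nDb)
  have sD : D.Subsingleton := h.subsingleton h2 hg hD hE (hleft D hD) nDb tDc (hright D hD)
    (hleft E hE) tEb nEc (hright E hE)
  have sE : E.Subsingleton := h.reverse.subsingleton h2 hg (hrev ▸ hE) (hrev ▸ hD) (hright E hE)
    nEc tEb (hleft E hE) (hright D hD) tDc nDb (hleft D hD)
  obtain ⟨p, hp⟩ := hD.conn.nonempty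
  obtain ⟨q, hq⟩ := hE.conn.nonempty
  have huniv : (Finset.univ : Finset α) ⊆ {a, b, c, d, p, q} := by
    intro x _
    by_cases hx : x ∈ ({a, b, c, d} : Set α)
    · simp only [Set.mem_insert_iff, Set.mem_singleton_iff] at hx
      simp only [Finset.mem_insert, Finset.mem_singleton]
      tauto
    · obtain ⟨F, hF, hxF⟩ := exists_isComp G (M := {a, b, c, d}ᶜ) hx
      rcases hcover F hF with rfl | rfl
      · simp [sD hxF hp]
      · simp [sE hxF hq]
  exact (Finset.card_le_card huniv).trans Finset.card_le_six

end Components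

end InducedPathFour

/-- **Decomposition of gem-induced minor-free graphs.** -/
theorem gem_free_decomposition {α : Type*} [Fintype α] (G : SimpleGraph α)
    (h2 : TwoConnected G) (hfree : ¬ IsInducedMinor gem G) :
    ∃ X : Finset α, X.card ≤ 6 ∧
      ∀ K : (G.induce {v | v ∉ X}).ConnectedComponent,
        IsCograph (G.induce (Subtype.val '' K.supp)) ∨
        IsBasicPath G (Subtype.val '' K.supp) := by
  classical
  have of_pair : (∃ u v, ∀ L, IsComp G {x | x ≠ u ∧ x ≠ v} L → IsCographOrPath G L) →
      ∃ X : Finset α, X.card ≤ 6 ∧ ∀ K : (G.induce {v | v ∉ X}).ConnectedComponent,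
        IsCographOrPath G (Subtype.val '' K.supp) := by
    rintro ⟨u, v, huv⟩
    refine ⟨{u, v}, Finset.card_le_two.trans (by omega), fun K => huv _ ?_⟩
    convert isComp_image_supp K using 1
    ext x
    simp
  by_cases hdeg : ∃ r, DegTwo G r
  · obtain ⟨r, hr⟩ := hdeg
    exact of_pair (exists_pair_of_degTwo h2 hfree hr)
  by_cases hsep : ∃ u v K, IsSeparation G u v K
  · obtain ⟨u, v, K, hK⟩ := hsep
    exact of_pair (exists_pair_of_isSeparation h2 hfree (by simpa using hdeg) hK)
  push Not at hsep
  by_cases hP : ∃ a b c d, IsPathFour G a b c d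
  · obtain ⟨a, b, c, d, hP⟩ := hP
    refine ⟨Finset.univ, hP.card_le_six h2 hfree hsep, fun K => ?_⟩
    obtain ⟨x, -⟩ := K.nonempty_supp
    exact (x.2 (Finset.mem_univ _)).elim
  · refine ⟨∅, by simp, fun K => Or.inl fun f hf hadj => hP ?_⟩
    have h : ∀ i j, G.Adj (f i).1 (f j).1 ↔ (pathGraph 4).Adj i j := hadj
    refine ⟨(f 0).1, (f 1).1, (f 2).1, (f 3).1, ?_, ?_, ?_, ?_, ?_, ?_⟩ <;>
      rw [h, pathGraph_adj] <;> decide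

end IMWQO
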